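/- arXiv:2205.01405 — 12 statements merged into one kernel-verified Lean document; each statement's English description precedes it below -/
import Mathlib

section
/- Let Q be an inverse semigroup and let S be a subsemigroup of Q which is a left I-order in Q. Then S is a straight left I-order in Q if and only if S intersects every 𝓛-class of Q, i.e., for every q ∈ Q there exists s ∈ S with s⁻¹·s = q⁻¹·q. -/
section InverseSemigroup

variable {Q : Type*} [Semigroup Q]

/-- In a semigroup with commuting idempotents, inverses are unique. -/
theorem inverse_unique_of_idempotents_comm
    (hcomm : ∀ e f : Q, e * e = e → f * f = f → e * f = f * e)
    {a x y : Q} (hx : a * x * a = a) (hx' : x * a * x = x)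
    (hy : a * y * a = a) (hy' : y * a * y = y) : x = y := by
  have hl : (x * a) * (y * a) = (y * a) * (x * a) :=
    hcomm _ _ (by rw [← mul_assoc, hx']) (by rw [← mul_assoc, hy'])
  have hr : (a * x) * (a * y) = (a * y) * (a * x) :=
    hcomm _ _ (by rw [← mul_assoc, hx]) (by rw [← mul_assoc, hy])
  calc x = x * (a * y * a) * x := by rw [hy, hx']
    _ = (x * a) * (y * a) * x := by simp only [mul_assoc]
    _ = y * a * (x * a * x) := by rw [hl]; simp only [mul_assoc]
    _ = (y * a * y) * a * x := by rw [hx', hy']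
    _ = y * ((a * y) * (a * x)) := by rw [← mul_assoc (a * y), hy]; simp only [← mul_assoc, hy']
    _ = y * (a * x * a) * y := by rw [← hr]; simp only [mul_assoc]
    _ = y := by rw [hx, hy']

theorem inverse_semigroup_inv_inv {inv : Q → Q} (hinv1 : ∀ a : Q, a * inv a * a = a)
    (hinv2 : ∀ a : Q, inv a * a * inv a = inv a)
    (hcomm : ∀ e f : Q, e * e = e → f * f = f → e * f = f * e) (a : Q) :
    inv (inv a) = a :=
  inverse_unique_of_idempotents_comm hcomm (hinv1 _) (hinv2 _) (hinv2 a) (hinv1 a)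

theorem inverse_semigroup_inv_mul {inv : Q → Q} (hinv1 : ∀ a : Q, a * inv a * a = a)
    (hinv2 : ∀ a : Q, inv a * a * inv a = inv a)
    (hcomm : ∀ e f : Q, e * e = e → f * f = f → e * f = f * e) (a b : Q) :
    inv (a * b) = inv b * inv a := by
  have h : (b * inv b) * (inv a * a) = (inv a * a) * (b * inv b) :=
    hcomm _ _ (by rw [← mul_assoc, hinv1]) (by rw [← mul_assoc, hinv2])
  refine inverse_unique_of_idempotents_comm hcomm (hinv1 _) (hinv2 _) ?_ ?_
  · calc a * b * (inv b * inv a) * (a * b)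
        = a * ((b * inv b) * (inv a * a)) * b := by simp only [mul_assoc]
      _ = (a * inv a * a) * (b * inv b * b) := by rw [h]; simp only [mul_assoc]
      _ = a * b := by rw [hinv1, hinv1]
  · calc inv b * inv a * (a * b) * (inv b * inv a)
        = inv b * ((inv a * a) * (b * inv b)) * inv a := by simp only [mul_assoc]
      _ = (inv b * b * inv b) * (inv a * a * inv a) := by rw [← h]; simp only [mul_assoc]
      _ = inv b * inv a := by rw [hinv2, hinv2]

end InverseSemigroup


/-- A left I-order `S` in an inverse semigroup `Q` is straight
iff `S` intersects every 𝓛-class of `Q`. -/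
theorem straight_iff_intersects_L_classes
    {Q : Type*} [Semigroup Q] (inv : Q → Q)
    (hinv1 : ∀ a : Q, a * inv a * a = a)
    (hinv2 : ∀ a : Q, inv a * a * inv a = inv a)
    (hcomm : ∀ e f : Q, e * e = e → f * f = f → e * f = f * e)
    (S : Subsemigroup Q)
    (hIorder : ∀ q : Q, ∃ a b : Q, a ∈ S ∧ b ∈ S ∧ q = inv a * b) :
    (∀ q : Q, ∃ a b : Q, a ∈ S ∧ b ∈ S ∧ q = inv a * b ∧ a * inv a = b * inv b)
      ↔ (∀ q : Q, ∃ s : Q, s ∈ S ∧ inv s * s = inv q * q) := by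
  have inv_mul := inverse_semigroup_inv_mul hinv1 hinv2 hcomm
  have inv_inv := inverse_semigroup_inv_inv hinv1 hinv2 hcomm
  constructor
  · intro h q
    obtain ⟨a, b, -, hb, rfl, hab⟩ := h q
    refine ⟨b, hb, ?_⟩
    calc inv b * b = inv b * (b * inv b) * b := by rw [← mul_assoc, hinv2]
      _ = inv (inv a * b) * (inv a * b) := by
        rw [← hab, inv_mul, inv_inv]; simp only [mul_assoc]
  · intro h q
    obtain ⟨a, b, ha, hb, rfl⟩ := hIorder q
    have hA : (a * inv a) * (a * inv a) = a * inv a := by rw [← mul_assoc, hinv1]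
    have hB : (b * inv b) * (b * inv b) = b * inv b := by rw [← mul_assoc, hinv1]
    have hAB := hcomm _ _ hA hB
    set e := (a * inv a) * (b * inv b) with he
    have heB : e * (b * inv b) = e := by rw [he, mul_assoc, hB]
    have heA : e * (a * inv a) = e := by rw [hAB, mul_assoc, hA]
    have hee : e * e = e := by
      calc e * e = e * (a * inv a) * (b * inv b) := (mul_assoc e _ _).symm
        _ = e := by rw [heA, heB]
    have hinv_e : inv e = e :=
      inverse_unique_of_idempotents_comm hcomm (hinv1 e) (hinv2 e)
        (by rw [hee, hee]) (by rw [hee, hee])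
    obtain ⟨u, hu, hue⟩ := h e
    rw [hinv_e, hee] at hue
    have range_eq : ∀ c : Q, e * (c * inv c) = e →
        u * c * inv (u * c) = u * e * inv u := by
      intro c hc
      calc u * c * inv (u * c) = (u * inv u * u) * c * (inv c * inv u) := by
            rw [inv_mul, hinv1]
        _ = u * ((inv u * u) * (c * inv c)) * inv u := by simp only [mul_assoc]
        _ = u * e * inv u := by rw [hue, hc]
    refine ⟨u * a, u * b, S.mul_mem hu ha, S.mul_mem hu hb, ?_, ?_⟩
    · calc inv a * b = (inv a * a * inv a) * (b * inv b * b) := by rw [hinv1, hinv2]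
        _ = inv a * e * b := by rw [he]; simp only [mul_assoc]
        _ = inv (u * a) * (u * b) := by rw [← hue, inv_mul]; simp only [mul_assoc]
    · rw [range_eq a heA, range_eq b heB]
end

section
/- Let Q be an inverse semigroup and let S be a subsemigroup of Q such that every q ∈ Q can be written as q = a⁻¹·b for some a, b ∈ S with a·a⁻¹ = a⁻¹·a (that is, a lies in a subgroup of Q, so a⁻¹ is its group inverse). Then S is a straight left I-order in Q: every q ∈ Q can be written as q = a⁻¹·b with a, b ∈ S and a·a⁻¹ = b·b⁻¹. -/
section InverseSemigroup

variable {Q : Type*} [Semigroup Q] {inv : Q → Q}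

theorem eq_inv_of_mul_mul_eq
    (hinv1 : ∀ a : Q, a * inv a * a = a)
    (hinv2 : ∀ a : Q, inv a * a * inv a = inv a)
    (hcomm : ∀ e f : Q, e * e = e → f * f = f → e * f = f * e)
    {a x : Q} (h₁ : a * x * a = a) (h₂ : x * a * x = x) : x = inv a := by
  have hl : x * a = inv a * a := by
    have := hcomm (x * a) (inv a * a) (by rw [← mul_assoc, h₂]) (by rw [← mul_assoc, hinv2])
    calc x * a = x * a * (inv a * a) := by
          rw [mul_assoc, ← mul_assoc a, hinv1]
      _ = inv a * a := by rw [this, mul_assoc, ← mul_assoc a, h₁]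
  have hr : a * x = a * inv a := by
    have := hcomm (a * x) (a * inv a) (by rw [← mul_assoc, h₁]) (by rw [← mul_assoc, hinv1])
    calc a * x = a * inv a * (a * x) := by rw [← mul_assoc, hinv1]
      _ = a * inv a := by rw [← this, ← mul_assoc, h₁]
  rw [← h₂, hl, mul_assoc, hr, ← mul_assoc, hinv2]

theorem inv_inv_of_inverse
    (hinv1 : ∀ a : Q, a * inv a * a = a)
    (hinv2 : ∀ a : Q, inv a * a * inv a = inv a)
    (hcomm : ∀ e f : Q, e * e = e → f * f = f → e * f = f * e)
    (a : Q) : inv (inv a) = a :=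
  (eq_inv_of_mul_mul_eq hinv1 hinv2 hcomm (hinv2 a) (hinv1 a)).symm

theorem inv_mul_rev_of_inverse
    (hinv1 : ∀ a : Q, a * inv a * a = a)
    (hinv2 : ∀ a : Q, inv a * a * inv a = inv a)
    (hcomm : ∀ e f : Q, e * e = e → f * f = f → e * f = f * e)
    (a b : Q) : inv (a * b) = inv b * inv a := by
  have hc := hcomm (b * inv b) (inv a * a) (by rw [← mul_assoc, hinv1])
    (by rw [← mul_assoc, hinv2])
  refine (eq_inv_of_mul_mul_eq hinv1 hinv2 hcomm ?_ ?_).symm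
  · calc a * b * (inv b * inv a) * (a * b) = a * (b * inv b * (inv a * a)) * b := by
          simp only [mul_assoc]
      _ = a * inv a * a * (b * inv b * b) := by rw [hc]; simp only [mul_assoc]
      _ = a * b := by rw [hinv1, hinv1]
  · calc inv b * inv a * (a * b) * (inv b * inv a)
        = inv b * (inv a * a * (b * inv b)) * inv a := by simp only [mul_assoc]
      _ = inv b * b * inv b * (inv a * a * inv a) := by rw [← hc]; simp only [mul_assoc]
      _ = inv b * inv a := by rw [hinv2, hinv2]

/-- If `a` lies in a subgroup, then `a * b` is `𝓛`-related to `a⁻¹ * b`. -/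
theorem inv_mul_self_mul_of_commute
    (hinv1 : ∀ a : Q, a * inv a * a = a)
    (hinv2 : ∀ a : Q, inv a * a * inv a = inv a)
    (hcomm : ∀ e f : Q, e * e = e → f * f = f → e * f = f * e)
    {a : Q} (ha : a * inv a = inv a * a) (b : Q) :
    inv (a * b) * (a * b) = inv (inv a * b) * (inv a * b) := by
  have hrev := inv_mul_rev_of_inverse hinv1 hinv2 hcomm
  rw [hrev, hrev, inv_inv_of_inverse hinv1 hinv2 hcomm]
  calc inv b * inv a * (a * b) = inv b * (inv a * a) * b := by simp only [mul_assoc]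
    _ = inv b * a * (inv a * b) := by rw [← ha]; simp only [mul_assoc]

/-- A left I-order meeting every `𝓛`-class is straight. -/
theorem straight_of_meets_L_classes
    (hinv1 : ∀ a : Q, a * inv a * a = a)
    (hinv2 : ∀ a : Q, inv a * a * inv a = inv a)
    (hcomm : ∀ e f : Q, e * e = e → f * f = f → e * f = f * e)
    (S : Subsemigroup Q)
    (hS : ∀ q : Q, ∃ a b : Q, a ∈ S ∧ b ∈ S ∧ q = inv a * b)
    (hL : ∀ q : Q, ∃ u ∈ S, inv u * u = inv q * q) (q : Q) :
    ∃ a b : Q, a ∈ S ∧ b ∈ S ∧ q = inv a * b ∧ a * inv a = b * inv b := by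
  have hrev := inv_mul_rev_of_inverse hinv1 hinv2 hcomm
  obtain ⟨a, b, ha, hb, rfl⟩ := hS q
  have hea : a * inv a * (a * inv a) = a * inv a := by rw [← mul_assoc, hinv1]
  have heb : b * inv b * (b * inv b) = b * inv b := by rw [← mul_assoc, hinv1]
  have hc := hcomm _ _ hea heb
  set e := a * inv a with he
  set f := b * inv b with hf
  have hg : e * f * (e * f) = e * f := by
    rw [mul_assoc, ← mul_assoc f, ← hc, mul_assoc e f f, heb, ← mul_assoc, hea]
  obtain ⟨u, hu, hug⟩ := hL (e * f)
  have hgi : e * f = inv (e * f) :=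
    eq_inv_of_mul_mul_eq hinv1 hinv2 hcomm (by rw [hg, hg]) (by rw [hg, hg])
  rw [← hgi, hg] at hug
  have hu' : u * (e * f) = u := by rw [← hug, ← mul_assoc, hinv1]
  have hue : u * e = u := by
    rw [← hu', mul_assoc, hc, mul_assoc, hea]
  have huf : u * f = u := by
    rw [← hu', mul_assoc, mul_assoc, heb]
  refine ⟨u * a, u * b, S.mul_mem hu ha, S.mul_mem hu hb, ?_, ?_⟩
  · calc inv a * b = inv a * e * (f * b) := by rw [he, hf, hinv1, ← mul_assoc, hinv2]
      _ = inv a * (inv u * u) * b := by rw [hug]; simp only [mul_assoc]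
      _ = inv (u * a) * (u * b) := by rw [hrev]; simp only [mul_assoc]
  · calc u * a * inv (u * a) = u * e * inv u := by rw [hrev, he]; simp only [mul_assoc]
      _ = u * f * inv u := by rw [hue, huf]
      _ = u * b * inv (u * b) := by rw [hrev, hf]; simp only [mul_assoc]

end InverseSemigroup


/-- If every element of `Q` is `a⁻¹·b` with `a, b ∈ S` and `a` lying
in a subgroup of `Q` (i.e. `a·a⁻¹ = a⁻¹·a`), then `S` is a straight left I-order in `Q`. -/
theorem fountainGould_implies_straight
    {Q : Type*} [Semigroup Q] (inv : Q → Q)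
    (hinv1 : ∀ a : Q, a * inv a * a = a)
    (hinv2 : ∀ a : Q, inv a * a * inv a = inv a)
    (hcomm : ∀ e f : Q, e * e = e → f * f = f → e * f = f * e)
    (S : Subsemigroup Q)
    (h : ∀ q : Q, ∃ a b : Q, a ∈ S ∧ b ∈ S ∧ q = inv a * b ∧ a * inv a = inv a * a) :
    ∀ q : Q, ∃ a b : Q, a ∈ S ∧ b ∈ S ∧ q = inv a * b ∧ a * inv a = b * inv b := by
  refine straight_of_meets_L_classes hinv1 hinv2 hcomm S (fun q => ?_) (fun q => ?_)
  · obtain ⟨a, b, ha, hb, hq, -⟩ := h q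
    exact ⟨a, b, ha, hb, hq⟩
  · obtain ⟨a, b, ha, hb, rfl, hgrp⟩ := h q
    exact ⟨a * b, S.mul_mem ha hb, inv_mul_self_mul_of_commute hinv1 hinv2 hcomm hgrp b⟩
end

section
/- Let Q be a finite inverse semigroup. Then every subsemigroup S of Q that is a left I-order in Q is a straight left I-order in Q. -/
/-- An inverse semigroup: a regular semigroup with a chosen inverse and commuting idempotents. -/
class InverseSemigroup (Q : Type*) extends Semigroup Q, Inv Q where
  mul_inv_mul (a : Q) : a * a⁻¹ * a = a
  inv_mul_inv (a : Q) : a⁻¹ * a * a⁻¹ = a⁻¹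
  idem_comm (e f : Q) : e * e = e → f * f = f → e * f = f * e

namespace InverseSemigroup

variable {Q : Type*} [InverseSemigroup Q]

lemma mul_inv_idem (a : Q) : (a * a⁻¹) * (a * a⁻¹) = a * a⁻¹ := by
  rw [← mul_assoc, mul_inv_mul]

lemma inv_mul_idem (a : Q) : (a⁻¹ * a) * (a⁻¹ * a) = a⁻¹ * a := by
  rw [← mul_assoc, inv_mul_inv]

lemma eq_inv_of_mul_mul {a b : Q} (h₁ : a * b * a = a) (h₂ : b * a * b = b) : b = a⁻¹ := by
  have hab : (a * b) * (a * b) = a * b := by rw [← mul_assoc, h₁]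
  have hba : (b * a) * (b * a) = b * a := by rw [← mul_assoc, h₂]
  have hr : a * b = a * a⁻¹ := by
    calc a * b = (a * a⁻¹) * (a * b) := by rw [← mul_assoc, mul_inv_mul]
      _ = (a * b) * (a * a⁻¹) := idem_comm _ _ (mul_inv_idem a) hab
      _ = a * a⁻¹ := by rw [← mul_assoc, h₁]
  have hl : b * a = a⁻¹ * a := by
    calc b * a = (b * a) * (a⁻¹ * a) := by
          rw [mul_assoc, ← mul_assoc a, mul_inv_mul]
      _ = (a⁻¹ * a) * (b * a) := idem_comm _ _ hba (inv_mul_idem a)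
      _ = a⁻¹ * a := by rw [mul_assoc, ← mul_assoc a, h₁]
  calc b = b * a * b := h₂.symm
    _ = a⁻¹ * (a * b) := by rw [hl, mul_assoc]
    _ = a⁻¹ := by rw [hr, ← mul_assoc, inv_mul_inv]

lemma inv_inv_eq (a : Q) : a⁻¹⁻¹ = a :=
  (eq_inv_of_mul_mul (inv_mul_inv a) (mul_inv_mul a)).symm

lemma inv_eq_self {e : Q} (he : e * e = e) : e⁻¹ = e :=
  (eq_inv_of_mul_mul (by rw [he, he]) (by rw [he, he])).symm

lemma mul_inv_rev_eq (a b : Q) : (a * b)⁻¹ = b⁻¹ * a⁻¹ := by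
  have h := idem_comm _ _ (mul_inv_idem b) (inv_mul_idem a)
  refine (eq_inv_of_mul_mul ?_ ?_).symm
  · calc a * b * (b⁻¹ * a⁻¹) * (a * b) = a * ((b * b⁻¹) * (a⁻¹ * a)) * b := by
          simp only [mul_assoc]
      _ = (a * a⁻¹ * a) * (b * b⁻¹ * b) := by rw [h]; simp only [mul_assoc]
      _ = a * b := by rw [mul_inv_mul, mul_inv_mul]
  · calc b⁻¹ * a⁻¹ * (a * b) * (b⁻¹ * a⁻¹) = b⁻¹ * ((a⁻¹ * a) * (b * b⁻¹)) * a⁻¹ := by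
          simp only [mul_assoc]
      _ = (b⁻¹ * b * b⁻¹) * (a⁻¹ * a * a⁻¹) := by rw [← h]; simp only [mul_assoc]
      _ = b⁻¹ * a⁻¹ := by rw [inv_mul_inv, inv_mul_inv]

lemma inv_inv_mul (a b : Q) : (a⁻¹ * b)⁻¹ = b⁻¹ * a := by
  rw [mul_inv_rev_eq, inv_inv_eq]

lemma conj_idem {e : Q} (he : e * e = e) (a : Q) :
    (a * e * a⁻¹) * (a * e * a⁻¹) = a * e * a⁻¹ := by
  have h := idem_comm _ _ he (inv_mul_idem a)
  calc (a * e * a⁻¹) * (a * e * a⁻¹) = a * (e * (a⁻¹ * a)) * e * a⁻¹ := by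
        simp only [mul_assoc]
    _ = (a * a⁻¹ * a) * (e * e) * a⁻¹ := by rw [h]; simp only [mul_assoc]
    _ = a * e * a⁻¹ := by rw [mul_inv_mul, he]

/-- If `a⁻¹ * b = q` with `a⁻¹ * a = q * q⁻¹`, then `a * a⁻¹ ≤ b * b⁻¹`. -/
lemma mul_inv_mul_mul_inv_of_domain {a b q : Q} (hq : q = a⁻¹ * b) (ha : a⁻¹ * a = q * q⁻¹) :
    (a * a⁻¹) * (b * b⁻¹) = a * a⁻¹ := by
  rw [hq, inv_inv_mul] at ha
  have h := idem_comm _ _ (mul_inv_idem a) (mul_inv_idem b)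
  calc (a * a⁻¹) * (b * b⁻¹) = (a * a⁻¹) * (a * a⁻¹) * (b * b⁻¹) := by rw [mul_inv_idem]
    _ = (a * a⁻¹) * ((b * b⁻¹) * (a * a⁻¹)) := by rw [mul_assoc, h]
    _ = a * (a⁻¹ * b * (b⁻¹ * a)) * a⁻¹ := by simp only [mul_assoc]
    _ = a * a⁻¹ := by rw [← ha, ← mul_assoc, mul_inv_mul]

/-- A quotient `a⁻¹ * b` whose `𝓛`-classes match those of `q` is automatically straight. -/
lemma mul_inv_eq_mul_inv_of_domains {a b q : Q} (hq : q = a⁻¹ * b)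
    (ha : a⁻¹ * a = q * q⁻¹) (hb : b⁻¹ * b = q⁻¹ * q) : a * a⁻¹ = b * b⁻¹ := by
  have h₁ := mul_inv_mul_mul_inv_of_domain hq ha
  have h₂ := mul_inv_mul_mul_inv_of_domain (a := b) (b := a) (q := q⁻¹)
    (by rw [hq, inv_inv_mul]) (by rw [inv_inv_eq, hb])
  rw [← h₁, ← h₂, idem_comm _ _ (mul_inv_idem b) (mul_inv_idem a), ← mul_assoc, mul_inv_idem]

lemma inv_mul_self_mul {a b q : Q} (hq : q = a⁻¹ * b) : a⁻¹ * a * q = q := by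
  rw [hq, ← mul_assoc, inv_mul_inv]

/-- If `c` has range inside the domain of `x`, then `x * c` has the same domain as `c`. -/
lemma domain_mul_of_le {c x : Q} (h : x⁻¹ * x * (c * c⁻¹) = c * c⁻¹) :
    (x * c)⁻¹ * (x * c) = c⁻¹ * c := by
  calc (x * c)⁻¹ * (x * c) = c⁻¹ * (x⁻¹ * x * (c * c⁻¹ * c)) := by
        rw [mul_inv_rev_eq, mul_inv_mul]; simp only [mul_assoc]
    _ = c⁻¹ * ((x⁻¹ * x * (c * c⁻¹)) * c) := by simp only [mul_assoc]
    _ = c⁻¹ * c := by rw [h, mul_inv_mul]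

/-- A left I-order meeting every `𝓛`-class is straight. -/
lemma straight_of_forall_domain {S : Subsemigroup Q}
    (hS : ∀ q : Q, ∃ a b : Q, a ∈ S ∧ b ∈ S ∧ q = a⁻¹ * b)
    (hdom : ∀ e : Q, e * e = e → ∃ c ∈ S, c⁻¹ * c = e) (q : Q) :
    ∃ a b : Q, a ∈ S ∧ b ∈ S ∧ q = a⁻¹ * b ∧ a * a⁻¹ = b * b⁻¹ := by
  obtain ⟨c, hc, hcq⟩ := hdom _ (mul_inv_idem q)
  obtain ⟨d, hd, hdq⟩ := hdom _ (inv_mul_idem q)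
  obtain ⟨x, y, hx, hy, hp⟩ := hS (c * q * d⁻¹)
  have hp' : (c * q * d⁻¹)⁻¹ = y⁻¹ * x := by rw [hp, inv_inv_mul]
  have hpinv : (c * q * d⁻¹)⁻¹ = d * q⁻¹ * c⁻¹ := by
    rw [mul_inv_rev_eq, mul_inv_rev_eq, inv_inv_eq, mul_assoc]
  have hpp : (c * q * d⁻¹) * (d * q⁻¹ * c⁻¹) = c * c⁻¹ := by
    calc (c * q * d⁻¹) * (d * q⁻¹ * c⁻¹) = c * (q * (d⁻¹ * d)) * q⁻¹ * c⁻¹ := by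
          simp only [mul_assoc]
      _ = c * (q * q⁻¹) * c⁻¹ := by
          rw [hdq, ← mul_assoc q, mul_inv_mul]; simp only [mul_assoc]
      _ = c * c⁻¹ := by rw [← hcq, ← mul_assoc, mul_inv_mul]
  have hpp' : (d * q⁻¹ * c⁻¹) * (c * q * d⁻¹) = d * d⁻¹ := by
    calc (d * q⁻¹ * c⁻¹) * (c * q * d⁻¹) = d * (q⁻¹ * (c⁻¹ * c)) * q * d⁻¹ := by
          simp only [mul_assoc]
      _ = d * (q⁻¹ * q) * d⁻¹ := by
          rw [hcq, ← mul_assoc q⁻¹, inv_mul_inv]; simp only [mul_assoc]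
      _ = d * d⁻¹ := by rw [← hdq, ← mul_assoc, mul_inv_mul]
  have hxc : x⁻¹ * x * (c * c⁻¹) = c * c⁻¹ := by
    rw [← hpp, ← mul_assoc, inv_mul_self_mul hp]
  have hyd : y⁻¹ * y * (d * d⁻¹) = d * d⁻¹ := by
    rw [← hpp', ← mul_assoc, ← hpinv, inv_mul_self_mul hp']
  have hq : q = (x * c)⁻¹ * (y * d) := by
    calc q = (q * q⁻¹) * q * (q⁻¹ * q) := by
          rw [mul_inv_mul, ← mul_assoc, mul_inv_mul]
      _ = c⁻¹ * (c * q * d⁻¹) * d := by rw [← hcq, ← hdq]; simp only [mul_assoc]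
      _ = (x * c)⁻¹ * (y * d) := by rw [hp, mul_inv_rev_eq]; simp only [mul_assoc]
  exact ⟨x * c, y * d, S.mul_mem hx hc, S.mul_mem hy hd, hq,
    mul_inv_eq_mul_inv_of_domains hq (by rw [domain_mul_of_le hxc, hcq])
      (by rw [domain_mul_of_le hyd, hdq])⟩

/-- Among the domains of elements of `S` lying above `e`, a finite `Q` has a minimal one. -/
lemma exists_minimal_domain [Finite Q] {S : Subsemigroup Q} {e : Q}
    (h : ∃ s ∈ S, s⁻¹ * s * e = e) :
    ∃ s ∈ S, s⁻¹ * s * e = e ∧ ∀ t ∈ S, t⁻¹ * t * e = e →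
      t⁻¹ * t * (s⁻¹ * s) = t⁻¹ * t → t⁻¹ * t = s⁻¹ * s := by
  let r : Q → Q → Prop := fun x y => x * y = x ∧ y * x = x ∧ x ≠ y
  have : IsTrans Q r := ⟨by
    rintro x y z ⟨h₁, h₂, h₃⟩ ⟨h₄, h₅, -⟩
    refine ⟨by rw [← h₁, mul_assoc, h₄], by rw [← h₂, ← mul_assoc, h₅], ?_⟩
    rintro rfl
    exact h₃ (h₁.symm.trans h₅)⟩
  have : Std.Irrefl r := ⟨fun x hx => hx.2.2 rfl⟩
  have hwf : WellFounded r := Finite.wellFounded_of_trans_of_irrefl r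
  obtain ⟨s₀, hs₀, hs₀e⟩ := h
  obtain ⟨f, ⟨s, hs, rfl, hse⟩, hmin⟩ :=
    hwf.has_min {f | ∃ s ∈ S, s⁻¹ * s = f ∧ f * e = e} ⟨_, s₀, hs₀, rfl, hs₀e⟩
  refine ⟨s, hs, hse, fun t ht hte hle => ?_⟩
  by_contra hne
  exact hmin _ ⟨t, ht, rfl, hte⟩
    ⟨hle, (idem_comm _ _ (inv_mul_idem s) (inv_mul_idem t)).trans hle, hne⟩

/-- If `e` is strictly below a minimal domain `f`, there are arbitrarily large families in `S`
of elements with domain `f`, any two of which have quotient `e`. -/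
lemma exists_large_family {S : Subsemigroup Q}
    (hS : ∀ q : Q, ∃ a b : Q, a ∈ S ∧ b ∈ S ∧ q = a⁻¹ * b) {e s : Q} (he : e * e = e)
    (hs : s ∈ S) (hse : s⁻¹ * s * e = e)
    (hmin : ∀ t ∈ S, t⁻¹ * t * e = e →
      t⁻¹ * t * (s⁻¹ * s) = t⁻¹ * t → t⁻¹ * t = s⁻¹ * s)
    (hne : s⁻¹ * s ≠ e) (n : ℕ) :
    ∃ F : Finset Q, F.card = n + 1 ∧ (∀ c ∈ F, c ∈ S ∧ c⁻¹ * c = s⁻¹ * s) ∧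
      ∀ c ∈ F, ∀ d ∈ F, c ≠ d → c⁻¹ * d = e := by
  classical
  have hes : e * (s⁻¹ * s) = e := (idem_comm _ _ he (inv_mul_idem s)).trans hse
  induction n with
  | zero => exact ⟨{s}, by simp, by simp [hs], by simp⟩
  | succ n ih =>
    obtain ⟨F, hcard, hF, hFe⟩ := ih
    obtain ⟨c₀, hc₀⟩ : F.Nonempty := Finset.card_pos.mp (by omega)
    obtain ⟨a, b, ha, hb, hg⟩ := hS (c₀ * e * c₀⁻¹)
    have hg' : c₀ * e * c₀⁻¹ = b⁻¹ * a := by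
      rw [← inv_eq_self (conj_idem he c₀), hg, inv_inv_mul]
    have hce : ∀ c ∈ F, c⁻¹ * c₀ * e = e := by
      intro c hc
      by_cases h : c = c₀
      · rw [h, (hF _ hc₀).2, hse]
      · rw [hFe c hc c₀ hc₀ h, he]
    have hec : ∀ c ∈ F, e * (c₀⁻¹ * c) = e := by
      intro c hc
      by_cases h : c₀ = c
      · rw [← h, (hF _ hc₀).2, hes]
      · rw [hFe c₀ hc₀ c hc h, he]
    have hconj : ∀ c ∈ F, ∀ d ∈ F, c⁻¹ * (c₀ * e * c₀⁻¹) * d = e := by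
      intro c hc d hd
      calc c⁻¹ * (c₀ * e * c₀⁻¹) * d = (c⁻¹ * c₀ * e) * (c₀⁻¹ * d) := by
            simp only [mul_assoc]
        _ = e := by rw [hce c hc, hec d hd]
    -- translating by an element of `S` whose domain contains `c₀ * e * c₀⁻¹` keeps domains
    have hdom : ∀ x ∈ S, x⁻¹ * x * (c₀ * e * c₀⁻¹) = c₀ * e * c₀⁻¹ → ∀ c ∈ F,
        (x * c)⁻¹ * (x * c) = s⁻¹ * s := by
      intro x hx hxg c hc
      have hcc := (hF c hc).2
      apply hmin _ (S.mul_mem hx (hF c hc).1)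
      · have hpr := idem_comm _ _ (inv_mul_idem x) (mul_inv_idem c)
        calc (x * c)⁻¹ * (x * c) * e
            = c⁻¹ * (x⁻¹ * x) * c * (c⁻¹ * (c₀ * e * c₀⁻¹) * c) := by
              rw [hconj c hc c hc, mul_inv_rev_eq]; simp only [mul_assoc]
          _ = c⁻¹ * ((x⁻¹ * x) * (c * c⁻¹)) * (c₀ * e * c₀⁻¹) * c := by
              simp only [mul_assoc]
          _ = (c⁻¹ * c * c⁻¹) * (x⁻¹ * x * (c₀ * e * c₀⁻¹)) * c := by
              rw [hpr]; simp only [mul_assoc]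
          _ = e := by rw [inv_mul_inv, hxg, hconj c hc c hc]
      · rw [← hcc, mul_assoc, mul_assoc x, ← mul_assoc c, mul_inv_mul]
    have hdoma := hdom a ha (inv_mul_self_mul hg)
    have hdomb := hdom b hb (inv_mul_self_mul hg')
    have haa : ∀ c ∈ F, ∀ d ∈ F, c ≠ d → (a * c)⁻¹ * (a * d) = e := by
      intro c hc d hd hcd
      have h₁ : c⁻¹ * (a⁻¹ * a) * c = c⁻¹ * c := by
        rw [(hF c hc).2, ← hdoma c hc, mul_inv_rev_eq]; simp only [mul_assoc]
      have h₂ : c⁻¹ * (a⁻¹ * a) = c⁻¹ := by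
        calc c⁻¹ * (a⁻¹ * a) = c⁻¹ * ((c * c⁻¹) * (a⁻¹ * a)) := by
              rw [← mul_assoc c⁻¹ (c * c⁻¹), ← mul_assoc c⁻¹ c, inv_mul_inv]
          _ = (c⁻¹ * (a⁻¹ * a) * c) * c⁻¹ := by
              rw [← idem_comm _ _ (inv_mul_idem a) (mul_inv_idem c)]; simp only [mul_assoc]
          _ = c⁻¹ := by rw [h₁, inv_mul_inv]
      rw [mul_inv_rev_eq, ← mul_assoc, mul_assoc c⁻¹, h₂, hFe c hc d hd hcd]
    have hab : ∀ c ∈ F, (a * c)⁻¹ * (b * c₀) = e := by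
      intro c hc
      rw [← hconj c hc c₀ hc₀, hg, mul_inv_rev_eq]
      simp only [mul_assoc]
    have hba : ∀ c ∈ F, (b * c₀)⁻¹ * (a * c) = e := by
      intro c hc
      rw [← inv_inv_mul, hab c hc, inv_eq_self he]
    have hinj : Set.InjOn (a * ·) (F : Set Q) := by
      intro c hc d hd hcd
      by_contra h
      apply hne
      rw [← hdoma c hc, ← haa c hc d hd h]
      exact congrArg ((a * c)⁻¹ * ·) hcd
    have hnot : b * c₀ ∉ F.image (a * ·) := by
      intro hmem
      obtain ⟨c, hc, hcb⟩ := Finset.mem_image.mp hmem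
      apply hne
      rw [← hdoma c hc, ← hab c hc]
      exact congrArg ((a * c)⁻¹ * ·) hcb
    refine ⟨insert (b * c₀) (F.image (a * ·)), ?_, ?_, ?_⟩
    · rw [Finset.card_insert_of_notMem hnot, Finset.card_image_of_injOn hinj, hcard]
    · intro x hx
      rcases Finset.mem_insert.mp hx with rfl | hx
      · exact ⟨S.mul_mem hb (hF _ hc₀).1, hdomb _ hc₀⟩
      · obtain ⟨c, hc, rfl⟩ := Finset.mem_image.mp hx
        exact ⟨S.mul_mem ha (hF _ hc).1, hdoma c hc⟩
    · intro x hx y hy hxy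
      rcases Finset.mem_insert.mp hx with rfl | hx <;> rcases Finset.mem_insert.mp hy with rfl | hy
      · exact absurd rfl hxy
      · obtain ⟨d, hd, rfl⟩ := Finset.mem_image.mp hy
        exact hba d hd
      · obtain ⟨c, hc, rfl⟩ := Finset.mem_image.mp hx
        exact hab c hc
      · obtain ⟨c, hc, rfl⟩ := Finset.mem_image.mp hx
        obtain ⟨d, hd, rfl⟩ := Finset.mem_image.mp hy
        exact haa c hc d hd fun h => hxy (congrArg (a * ·) h)

/-- A left I-order in a finite inverse semigroup meets every `𝓛`-class. -/
lemma exists_mem_domain_eq [Finite Q] {S : Subsemigroup Q}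
    (hS : ∀ q : Q, ∃ a b : Q, a ∈ S ∧ b ∈ S ∧ q = a⁻¹ * b) (e : Q) (he : e * e = e) :
    ∃ c ∈ S, c⁻¹ * c = e := by
  obtain ⟨a, b, ha, -, hab⟩ := hS e
  obtain ⟨s, hs, hse, hmin⟩ := exists_minimal_domain ⟨a, ha, inv_mul_self_mul hab⟩
  refine ⟨s, hs, ?_⟩
  by_contra hne
  obtain ⟨F, hF, -⟩ := exists_large_family hS he hs hse hmin hne (Nat.card Q)
  have hle : F.card ≤ Nat.card Q := by
    rw [← Set.ncard_coe_finset]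
    exact Set.ncard_le_card _
  omega

end InverseSemigroup

/-- In a finite inverse semigroup every left I-order is straight. -/
theorem leftIOrder_straight_of_finite
    {Q : Type*} [Semigroup Q] [Finite Q] (inv : Q → Q)
    (hinv1 : ∀ a : Q, a * inv a * a = a)
    (hinv2 : ∀ a : Q, inv a * a * inv a = inv a)
    (hcomm : ∀ e f : Q, e * e = e → f * f = f → e * f = f * e)
    (S : Subsemigroup Q)
    (hIorder : ∀ q : Q, ∃ a b : Q, a ∈ S ∧ b ∈ S ∧ q = inv a * b) :
    ∀ q : Q, ∃ a b : Q, a ∈ S ∧ b ∈ S ∧ q = inv a * b ∧ a * inv a = b * inv b := by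
  let _ : InverseSemigroup Q :=
    { inv := inv
      mul_inv_mul := hinv1
      inv_mul_inv := hinv2
      idem_comm := hcomm }
  exact InverseSemigroup.straight_of_forall_domain (S := S) hIorder
    (InverseSemigroup.exists_mem_domain_eq (S := S) hIorder)
end

section
/- Let Q be an inverse semigroup and let S be a subsemigroup of Q that is a straight left I-order in Q. Let a, b, c, d ∈ S with a 𝓡 b and c 𝓡 d in Q. Then a⁻¹·b = c⁻¹·d if and only if there exist x, y ∈ S such that x·a = y·c, x·b = y·d, x 𝓡 x·a, x·a 𝓛 a, y 𝓡 y·c, and y·c 𝓛 c, where all Green's relations are taken in Q. -/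
namespace InverseSemigroup

variable {Q : Type*} [Semigroup Q] {inv : Q → Q}

/-- Inverses in an inverse semigroup are unique. -/
theorem eq_inv
    (hinv1 : ∀ a : Q, a * inv a * a = a)
    (hinv2 : ∀ a : Q, inv a * a * inv a = inv a)
    (hcomm : ∀ e f : Q, e * e = e → f * f = f → e * f = f * e)
    {a p : Q} (h1 : a * p * a = a) (h2 : p * a * p = p) : p = inv a := by
  have e1 : (a * p) * (a * p) = a * p := by rw [← mul_assoc, h1]
  have e2 : (a * inv a) * (a * inv a) = a * inv a := by rw [← mul_assoc, hinv1]
  have e3 : (p * a) * (p * a) = p * a := by rw [← mul_assoc, h2]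
  have e4 : (inv a * a) * (inv a * a) = inv a * a := by rw [← mul_assoc, hinv2]
  calc p = p * (a * inv a * a) * p := by rw [hinv1, h2]
    _ = p * ((a * inv a) * (a * p)) := by simp only [mul_assoc]
    _ = p * ((a * p) * (a * inv a)) := by rw [hcomm _ _ e2 e1]
    _ = (p * a * p) * a * inv a := by simp only [mul_assoc]
    _ = (p * a) * (inv a * a * inv a) := by rw [h2, hinv2, mul_assoc]
    _ = (p * a) * (inv a * a) * inv a := by simp only [mul_assoc]
    _ = (inv a * a) * (p * a) * inv a := by rw [hcomm _ _ e3 e4]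
    _ = inv a * (a * p * a) * inv a := by simp only [mul_assoc]
    _ = inv a := by rw [h1, hinv2]

theorem inv_inv
    (hinv1 : ∀ a : Q, a * inv a * a = a)
    (hinv2 : ∀ a : Q, inv a * a * inv a = inv a)
    (hcomm : ∀ e f : Q, e * e = e → f * f = f → e * f = f * e)
    (a : Q) : inv (inv a) = a :=
  (eq_inv hinv1 hinv2 hcomm (hinv2 a) (hinv1 a)).symm

theorem mul_inv_rev
    (hinv1 : ∀ a : Q, a * inv a * a = a)
    (hinv2 : ∀ a : Q, inv a * a * inv a = inv a)
    (hcomm : ∀ e f : Q, e * e = e → f * f = f → e * f = f * e)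
    (a b : Q) : inv (a * b) = inv b * inv a := by
  have e1 : (b * inv b) * (b * inv b) = b * inv b := by rw [← mul_assoc, hinv1]
  have e2 : (inv a * a) * (inv a * a) = inv a * a := by rw [← mul_assoc, hinv2]
  refine (eq_inv hinv1 hinv2 hcomm ?_ ?_).symm
  · calc a * b * (inv b * inv a) * (a * b)
        = a * ((b * inv b) * (inv a * a)) * b := by simp only [mul_assoc]
      _ = a * ((inv a * a) * (b * inv b)) * b := by rw [hcomm _ _ e1 e2]
      _ = (a * inv a * a) * (b * inv b * b) := by simp only [mul_assoc]
      _ = a * b := by rw [hinv1, hinv1]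
  · calc inv b * inv a * (a * b) * (inv b * inv a)
        = inv b * ((inv a * a) * (b * inv b)) * inv a := by simp only [mul_assoc]
      _ = inv b * ((b * inv b) * (inv a * a)) * inv a := by rw [hcomm _ _ e1 e2]
      _ = (inv b * b * inv b) * (inv a * a * inv a) := by simp only [mul_assoc]
      _ = inv b * inv a := by rw [hinv2, hinv2]

/-- If `a 𝓡 b`, then `a⁻¹ * b 𝓡 a⁻¹`. -/
theorem inv_mul_mul_inv
    (hinv1 : ∀ a : Q, a * inv a * a = a)
    (hinv2 : ∀ a : Q, inv a * a * inv a = inv a)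
    (hcomm : ∀ e f : Q, e * e = e → f * f = f → e * f = f * e)
    {a b : Q} (hab : a * inv a = b * inv b) :
    (inv a * b) * inv (inv a * b) = inv a * a := by
  calc (inv a * b) * inv (inv a * b)
      = inv a * (b * inv b) * a := by
        rw [mul_inv_rev hinv1 hinv2 hcomm, inv_inv hinv1 hinv2 hcomm]
        simp only [mul_assoc]
    _ = (inv a * a * inv a) * a := by rw [← hab]; simp only [mul_assoc]
    _ = inv a * a := by rw [hinv2]

/-- If `a 𝓡 b`, then `a⁻¹ * b 𝓛 b`. -/
theorem inv_mul_inv_mul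
    (hinv1 : ∀ a : Q, a * inv a * a = a)
    (hinv2 : ∀ a : Q, inv a * a * inv a = inv a)
    (hcomm : ∀ e f : Q, e * e = e → f * f = f → e * f = f * e)
    {a b : Q} (hab : a * inv a = b * inv b) :
    inv (inv a * b) * (inv a * b) = inv b * b := by
  rw [mul_inv_rev hinv1 hinv2 hcomm, inv_inv hinv1 hinv2 hcomm,
    ← inv_mul_mul_inv hinv1 hinv2 hcomm hab.symm, mul_inv_rev hinv1 hinv2 hcomm,
    inv_inv hinv1 hinv2 hcomm]

/-- If `x⁻¹ * x = a * a⁻¹`, then `x 𝓡 x * a 𝓛 a`. -/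
theorem mul_green_of_inv_mul_eq
    (hinv1 : ∀ a : Q, a * inv a * a = a)
    (hinv2 : ∀ a : Q, inv a * a * inv a = inv a)
    (hcomm : ∀ e f : Q, e * e = e → f * f = f → e * f = f * e)
    {x a : Q} (h : inv x * x = a * inv a) :
    x * inv x = (x * a) * inv (x * a) ∧ inv (x * a) * (x * a) = inv a * a := by
  have hx : inv x * inv (inv x) = a * inv a := by rw [inv_inv hinv1 hinv2 hcomm, h]
  have hr := inv_mul_mul_inv hinv1 hinv2 hcomm hx
  have hl := inv_mul_inv_mul hinv1 hinv2 hcomm hx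
  rw [inv_inv hinv1 hinv2 hcomm] at hr hl
  exact ⟨hr.symm, hl⟩

/-- Quotients of `𝓡`-related elements may be expanded on the left by `x` when `x * a 𝓛 a`. -/
theorem inv_mul_mul_eq
    (hinv1 : ∀ a : Q, a * inv a * a = a)
    (hinv2 : ∀ a : Q, inv a * a * inv a = inv a)
    {x a b : Q} (hab : a * inv a = b * inv b) (h : inv (x * a) * (x * a) = inv a * a) :
    inv (x * a) * (x * b) = inv a * b := by
  calc inv (x * a) * (x * b)
      = inv (x * a) * (x * (b * inv b * b)) := by rw [hinv1]
    _ = inv (x * a) * (x * a) * (inv a * b) := by rw [← hab]; simp only [mul_assoc]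
    _ = inv a * a * inv a * b := by rw [h]; simp only [mul_assoc]
    _ = inv a * b := by rw [hinv2]

end InverseSemigroup

open InverseSemigroup

/-- Equality of quotients in a straight left I-order. -/
theorem quotient_eq_iff
    {Q : Type*} [Semigroup Q] (inv : Q → Q)
    (hinv1 : ∀ a : Q, a * inv a * a = a)
    (hinv2 : ∀ a : Q, inv a * a * inv a = inv a)
    (hcomm : ∀ e f : Q, e * e = e → f * f = f → e * f = f * e)
    (S : Subsemigroup Q)
    (hstraight : ∀ q : Q, ∃ a b : Q, a ∈ S ∧ b ∈ S ∧ q = inv a * b ∧ a * inv a = b * inv b)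
    (a b c d : Q) (ha : a ∈ S) (hb : b ∈ S) (hc : c ∈ S) (hd : d ∈ S)
    (hab : a * inv a = b * inv b) (hcd : c * inv c = d * inv d) :
    inv a * b = inv c * d ↔
      ∃ x y : Q, x ∈ S ∧ y ∈ S ∧ x * a = y * c ∧ x * b = y * d ∧
        x * inv x = (x * a) * inv (x * a) ∧ inv (x * a) * (x * a) = inv a * a ∧
        y * inv y = (y * c) * inv (y * c) ∧ inv (y * c) * (y * c) = inv c * c := by
  constructor
  · intro h
    have hL : inv a * a = inv c * c := by
      rw [← inv_mul_mul_inv hinv1 hinv2 hcomm hab, h, inv_mul_mul_inv hinv1 hinv2 hcomm hcd]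
    obtain ⟨x, y, hx, hy, hq, hxy⟩ := hstraight (a * inv c)
    have hL' : inv a * inv (inv a) = inv c * inv (inv c) := by
      rw [inv_inv hinv1 hinv2 hcomm, inv_inv hinv1 hinv2 hcomm, hL]
    have hxa : inv x * x = a * inv a := by
      have hr := inv_mul_mul_inv hinv1 hinv2 hcomm hL'
      rw [inv_inv hinv1 hinv2 hcomm, hq, inv_mul_mul_inv hinv1 hinv2 hcomm hxy] at hr
      exact hr
    have hyc : inv y * y = c * inv c := by
      have hl := inv_mul_inv_mul hinv1 hinv2 hcomm hL'
      rw [inv_inv hinv1 hinv2 hcomm, inv_inv hinv1 hinv2 hcomm, hq,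
        inv_mul_inv_mul hinv1 hinv2 hcomm hxy] at hl
      exact hl
    have hy' : y = x * (a * inv c) := by rw [hq, ← mul_assoc, hxy, hinv1]
    obtain ⟨hx1, hx2⟩ := mul_green_of_inv_mul_eq hinv1 hinv2 hcomm hxa
    obtain ⟨hy1, hy2⟩ := mul_green_of_inv_mul_eq hinv1 hinv2 hcomm hyc
    refine ⟨x, y, hx, hy, ?_, ?_, hx1, hx2, hy1, hy2⟩
    · calc x * a = x * (a * inv a * a) := by rw [hinv1]
        _ = x * (a * (inv c * c)) := by rw [← hL, mul_assoc]
        _ = y * c := by rw [hy']; simp only [mul_assoc]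
    · calc x * b = x * (b * inv b * b) := by rw [hinv1]
        _ = x * (a * (inv c * d)) := by rw [← hab, ← h, mul_assoc]
        _ = y * d := by rw [hy']; simp only [mul_assoc]
  · rintro ⟨x, y, -, -, hxa, hxb, -, hxL, -, hyL⟩
    rw [← inv_mul_mul_eq hinv1 hinv2 hab hxL, hxa, hxb,
      inv_mul_mul_eq hinv1 hinv2 hcd hyL]
end

section
/- Let S be a semigroup, Q an inverse semigroup, and φ : S → Q an injective semigroup homomorphism such that every q ∈ Q can be written as q = (φ a)⁻¹·(φ b) for some a, b ∈ S with φ a 𝓡 φ b in Q. Define relations on S by: a R' b iff φ a 𝓡 φ b in Q, and a ≤_l b iff φ a ≤_𝓛 φ b in Q. Then R' is a left compatible equivalence relation on S, ≤_l is a preorder on S whose 𝓛'-classes form a meet semilattice under ≤_l, and Conditions (M1)–(M6) hold. -/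
/-- A relation is left compatible if it is preserved by left multiplication. -/
def LeftCompatible {S : Type*} [Semigroup S] (R : S → S → Prop) : Prop :=
  ∀ c a b : S, R a b → R (c * a) (c * b)

/-- `c` realizes the meet of the 𝓛'-classes of `a` and `b` with respect to the
preorder `le`. -/
def IsMeet {S : Type*} (le : S → S → Prop) (a b c : S) : Prop :=
  le c a ∧ le c b ∧ ∀ d, le d a → le d b → le d c

/-- The equivalence relation 𝓛' associated with the preorder `le`. -/
def LpRel {S : Type*} (le : S → S → Prop) (a b : S) : Prop :=
  le a b ∧ le b a

/-- The relation 𝓡* on a semigroup `S`, defined via `S¹ = WithOne S`. -/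
def RStar {S : Type*} [Semigroup S] (a b : S) : Prop :=
  ∀ x y : WithOne S,
    x * (a : WithOne S) = y * (a : WithOne S) ↔ x * (b : WithOne S) = y * (b : WithOne S)

/-- Condition (M1). -/
def CondM1 {S : Type*} [Semigroup S] (R le : S → S → Prop) : Prop :=
  ∀ a b : S, ∃ c d : S, R c d ∧ R d (d * b) ∧ d * b = c * a ∧ IsMeet le a b (c * a)

/-- Condition (M2). -/
def CondM2 {S : Type*} [Semigroup S] (le : S → S → Prop) : Prop :=
  ∀ a b c d : S, IsMeet le a b c → IsMeet le (a * d) (b * d) (c * d)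

/-- Condition (M3). -/
def CondM3 {S : Type*} [Semigroup S] (le : S → S → Prop) : Prop :=
  ∀ a b : S, le (a * b) b

/-- Condition (M4). -/
def CondM4 {S : Type*} [Semigroup S] (R : S → S → Prop) : Prop :=
  ∀ a b : S, R a b → RStar a b

/-- Condition (M5). -/
def CondM5 {S : Type*} [Semigroup S] (R le : S → S → Prop) : Prop :=
  ∀ a b c d : S, R c (c * a) → LpRel le (c * a) a → R d (d * b) → LpRel le (d * b) b →
    (LpRel le c d ↔ R a b)

/-- Condition (M6). -/
def CondM6 {S : Type*} [Semigroup S] (le : S → S → Prop) : Prop :=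
  ∀ a b c : S, LpRel le a b → LpRel le b (c * a) → c * a = c * b → a = b

/-- The operation `inv` turns the semigroup `Q` into an inverse semigroup. -/
structure IsInverseOp {Q : Type*} [Semigroup Q] (inv : Q → Q) : Prop where
  mul_inv_mul : ∀ a : Q, a * inv a * a = a
  inv_mul_inv : ∀ a : Q, inv a * a * inv a = inv a
  comm : ∀ e f : Q, e * e = e → f * f = f → e * f = f * e

namespace IsInverseOp

variable {Q : Type*} [Semigroup Q] {inv : Q → Q}

theorem mul_inv_idem (h : IsInverseOp inv) (a : Q) : a * inv a * (a * inv a) = a * inv a := by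
  rw [← mul_assoc, h.mul_inv_mul]

theorem inv_mul_idem (h : IsInverseOp inv) (a : Q) : inv a * a * (inv a * a) = inv a * a := by
  rw [← mul_assoc, h.inv_mul_inv]

theorem mul_inv_mul_self (h : IsInverseOp inv) (a : Q) : a * (inv a * a) = a := by
  rw [← mul_assoc, h.mul_inv_mul]

theorem comm_dom (h : IsInverseOp inv) (a b : Q) :
    inv a * a * (inv b * b) = inv b * b * (inv a * a) :=
  h.comm _ _ (h.inv_mul_idem a) (h.inv_mul_idem b)

theorem comm_dom_ran (h : IsInverseOp inv) (a b : Q) :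
    inv a * a * (b * inv b) = b * inv b * (inv a * a) :=
  h.comm _ _ (h.inv_mul_idem a) (h.mul_inv_idem b)

theorem eq_inv (h : IsInverseOp inv) {x y : Q} (hxy : x * y * x = x) (hyx : y * x * y = y) :
    y = inv x := by
  have hxy' : x * y * (x * y) = x * y := by rw [← mul_assoc, hxy]
  have hyx' : y * x * (y * x) = y * x := by rw [← mul_assoc, hyx]
  calc y = y * (x * inv x * x) * y := by rw [h.mul_inv_mul, hyx]
    _ = y * x * (inv x * x) * y := by simp only [mul_assoc]
    _ = inv x * x * (y * x) * y := by rw [h.comm _ _ hyx' (h.inv_mul_idem x)]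
    _ = inv x * (x * y * x) * y := by simp only [mul_assoc]
    _ = inv x * x * inv x * (x * y) := by rw [hxy, h.inv_mul_inv, mul_assoc]
    _ = inv x * (x * inv x * (x * y)) := by simp only [mul_assoc]
    _ = inv x * (x * y * (x * inv x)) := by rw [h.comm _ _ hxy' (h.mul_inv_idem x)]
    _ = inv x * (x * y * x) * inv x := by simp only [mul_assoc]
    _ = inv x := by rw [hxy, h.inv_mul_inv]

theorem inv_inv (h : IsInverseOp inv) (a : Q) : inv (inv a) = a :=
  (h.eq_inv (h.inv_mul_inv a) (h.mul_inv_mul a)).symm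

theorem inv_mul (h : IsInverseOp inv) (a b : Q) : inv (a * b) = inv b * inv a := by
  refine (h.eq_inv ?_ ?_).symm
  · calc a * b * (inv b * inv a) * (a * b)
        = a * (b * inv b * (inv a * a)) * b := by simp only [mul_assoc]
      _ = a * (inv a * a * (b * inv b)) * b := by rw [h.comm_dom_ran]
      _ = a * inv a * a * (b * inv b * b) := by simp only [mul_assoc]
      _ = a * b := by rw [h.mul_inv_mul, h.mul_inv_mul]
  · calc inv b * inv a * (a * b) * (inv b * inv a)
        = inv b * (inv a * a * (b * inv b)) * inv a := by simp only [mul_assoc]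
      _ = inv b * (b * inv b * (inv a * a)) * inv a := by rw [h.comm_dom_ran]
      _ = inv b * b * inv b * (inv a * a * inv a) := by simp only [mul_assoc]
      _ = inv b * inv a := by rw [h.inv_mul_inv, h.inv_mul_inv]

/-- The domain idempotent of a product. -/
theorem dom_mul (h : IsInverseOp inv) (a b : Q) :
    inv (a * b) * (a * b) = inv b * (inv a * a) * b := by
  rw [h.inv_mul]; simp only [mul_assoc]

/-- The range idempotent of a product. -/
theorem ran_mul (h : IsInverseOp inv) (a b : Q) :
    a * b * inv (a * b) = a * (b * inv b) * inv a := by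
  rw [h.inv_mul]; simp only [mul_assoc]

theorem dom_mul_dom_eq_iff (h : IsInverseOp inv) {a e : Q} :
    inv a * a * e = inv a * a ↔ a * e = a := by
  constructor <;> intro H
  · rw [← h.mul_inv_mul_self a, mul_assoc, H]
  · rw [mul_assoc, H]

theorem dom_eq_of_le_of_le (h : IsInverseOp inv) {a b : Q}
    (hab : inv a * a * (inv b * b) = inv a * a) (hba : inv b * b * (inv a * a) = inv b * b) :
    inv a * a = inv b * b := by
  rw [← hab, h.comm_dom, hba]

theorem mul_ran_eq_iff (h : IsInverseOp inv) {c a : Q} :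
    c * inv c = c * a * inv (c * a) ↔ c * (a * inv a) = c := by
  rw [h.ran_mul]
  constructor <;> intro H
  · calc c * (a * inv a) = c * inv c * c * (a * inv a) := by rw [h.mul_inv_mul]
      _ = c * (inv c * c * (a * inv a)) := by simp only [mul_assoc]
      _ = c * (a * inv a) * inv c * c := by rw [h.comm_dom_ran]; simp only [mul_assoc]
      _ = c := by rw [← H, h.mul_inv_mul]
  · rw [H]

theorem dom_mul_eq_self (h : IsInverseOp inv) {c a : Q}
    (H : inv (c * a) * (c * a) = inv a * a) : inv c * c * a = a := by
  rw [h.dom_mul] at H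
  calc inv c * c * a = inv c * c * (a * inv a * a) := by rw [h.mul_inv_mul]
    _ = inv c * c * (a * inv a) * a := by simp only [mul_assoc]
    _ = a * (inv a * (inv c * c) * a) := by rw [h.comm_dom_ran]; simp only [mul_assoc]
    _ = a := by rw [H, h.mul_inv_mul_self]

theorem dom_eq_ran (h : IsInverseOp inv) {c a : Q} (hR : c * inv c = c * a * inv (c * a))
    (hL : inv (c * a) * (c * a) = inv a * a) : inv c * c = a * inv a := by
  rw [← h.dom_mul_dom_eq_iff.2 (h.mul_ran_eq_iff.1 hR), ← mul_assoc, h.dom_mul_eq_self hL]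

theorem ran_mul_ran_left (h : IsInverseOp inv) {a b : Q} (hab : a * inv a = b * inv b) (c : Q) :
    c * a * inv (c * a) = c * b * inv (c * b) := by
  rw [h.ran_mul, h.ran_mul, hab]

theorem mul_inv_mul_of_ran_eq (h : IsInverseOp inv) {a b : Q} (hab : a * inv a = b * inv b) :
    a * (inv a * b) = b := by
  rw [← mul_assoc, hab, h.mul_inv_mul]

/-- The domain idempotent of `a * d` is multiplicative in the domain idempotent of `a`. -/
theorem dom_mul_of_dom_eq_mul (h : IsInverseOp inv) {a b c : Q} (d : Q)
    (H : inv c * c = inv a * a * (inv b * b)) :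
    inv (c * d) * (c * d) = inv (a * d) * (a * d) * (inv (b * d) * (b * d)) := by
  rw [h.dom_mul, h.dom_mul, h.dom_mul, H]
  calc inv d * (inv a * a * (inv b * b)) * d
      = inv d * (inv a * a * (inv b * b)) * (d * inv d * d) := by rw [h.mul_inv_mul]
    _ = inv d * (inv a * a) * (inv b * b * (d * inv d)) * d := by simp only [mul_assoc]
    _ = _ := by rw [h.comm_dom_ran]; simp only [mul_assoc]

/-- Writing `a * inv b` as a left quotient `inv c * d` yields a common left multiple of
`a` and `b` whose domain idempotent is the product of those of `a` and `b`. -/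
theorem common_multiple (h : IsInverseOp inv) {a b c d : Q} (hq : a * inv b = inv c * d)
    (hcd : c * inv c = d * inv d) :
    d * inv d = d * b * inv (d * b) ∧ d * b = c * a ∧
      inv (c * a) * (c * a) = inv a * a * (inv b * b) := by
  have hd : c * (a * inv b) = d := by rw [hq, h.mul_inv_mul_of_ran_eq hcd]
  have hc : inv c * c = a * (inv b * b) * inv a := by
    calc inv c * c = inv c * (c * inv c) * c := by rw [← mul_assoc, h.inv_mul_inv]
      _ = inv c * d * inv (inv c * d) := by
          rw [hcd, h.inv_mul, h.inv_inv]; simp only [mul_assoc]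
      _ = a * (inv b * b) * inv a := by
          rw [← hq, h.inv_mul, h.inv_inv]; simp only [mul_assoc]
  have hca : inv c * c * a = a * (inv b * b) := by
    calc inv c * c * a = a * (inv b * b * (inv a * a)) := by rw [hc]; simp only [mul_assoc]
      _ = a * (inv a * a) * (inv b * b) := by rw [h.comm_dom, ← mul_assoc]
      _ = a * (inv b * b) := by rw [h.mul_inv_mul_self]
  refine ⟨h.mul_ran_eq_iff.2 ?_, ?_, ?_⟩
  · calc d * (b * inv b) = c * a * (inv b * b * inv b) := by rw [← hd]; simp only [mul_assoc]
      _ = d := by rw [h.inv_mul_inv, mul_assoc, hd]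
  · calc d * b = c * (a * (inv b * b)) := by rw [← hd]; simp only [mul_assoc]
      _ = c * (inv c * c) * a := by rw [← hca]; simp only [mul_assoc]
      _ = c * a := by rw [h.mul_inv_mul_self]
  · rw [h.dom_mul, mul_assoc, hca, ← mul_assoc]

/-- The product of the domain idempotents of `a` and `b` is their greatest lower bound. -/
theorem isMeet_of_dom_eq_mul (h : IsInverseOp inv) {S : Type*} (f : S → Q) {a b c : S}
    (H : inv (f c) * f c = inv (f a) * f a * (inv (f b) * f b)) :
    IsMeet (fun x y => inv (f x) * f x * (inv (f y) * f y) = inv (f x) * f x) a b c := by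
  refine ⟨?_, ?_, fun d ha hb => ?_⟩ <;> beta_reduce at *
  · rw [H, mul_assoc, h.comm_dom (f b), ← mul_assoc, h.inv_mul_idem]
  · rw [H, mul_assoc, h.inv_mul_idem]
  · rw [H, ← mul_assoc, ha, hb]

end IsInverseOp

/-- necessity direction of Theorem `main`: if `S` is a straight left
I-order in an inverse semigroup `Q` via the embedding `φ`, then the induced relations
`R'` and `≤_l` satisfy all the conditions of the main theorem. -/
theorem main_necessity
    {S Q : Type*} [Semigroup S] [Semigroup Q] (inv : Q → Q)
    (hinv1 : ∀ a : Q, a * inv a * a = a)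
    (hinv2 : ∀ a : Q, inv a * a * inv a = inv a)
    (hcomm : ∀ e f : Q, e * e = e → f * f = f → e * f = f * e)
    (φ : S →ₙ* Q) (hinj : Function.Injective φ)
    (hstraight : ∀ q : Q, ∃ a b : S,
      q = inv (φ a) * φ b ∧ φ a * inv (φ a) = φ b * inv (φ b)) :
    let R : S → S → Prop := fun a b => φ a * inv (φ a) = φ b * inv (φ b)
    let le : S → S → Prop := fun a b =>
      inv (φ a) * φ a * (inv (φ b) * φ b) = inv (φ a) * φ a
    Equivalence R ∧ LeftCompatible R ∧
      (∀ a : S, le a a) ∧ (∀ a b c : S, le a b → le b c → le a c) ∧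
      (∀ a b : S, ∃ c : S, IsMeet le a b c) ∧
      CondM1 R le ∧ CondM2 le ∧ CondM3 le ∧ CondM4 R ∧ CondM5 R le ∧ CondM6 le := by
  intro R le
  have h : IsInverseOp inv := ⟨hinv1, hinv2, hcomm⟩
  have dom_eq {a b : S} (hab : LpRel le a b) : inv (φ a) * φ a = inv (φ b) * φ b :=
    h.dom_eq_of_le_of_le hab.1 hab.2
  have le_of_dom_eq {a b : S} (hab : inv (φ a) * φ a = inv (φ b) * φ b) : le a b := by
    simp only [le, hab, h.inv_mul_idem]
  have exists_multiple (a b : S) : ∃ c d : S, R c d ∧ R d (d * b) ∧ d * b = c * a ∧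
      inv (φ (c * a)) * φ (c * a) = inv (φ a) * φ a * (inv (φ b) * φ b) := by
    obtain ⟨c, d, hq, hcd⟩ := hstraight (φ a * inv (φ b))
    obtain ⟨hd, hdc, hdom⟩ := h.common_multiple hq hcd
    simp only [← map_mul] at hd hdc hdom
    exact ⟨c, d, hcd, hd, hinj hdc, hdom⟩
  have m1 : CondM1 R le := fun a b => by
    obtain ⟨c, d, hcd, hd, hdc, hdom⟩ := exists_multiple a b
    exact ⟨c, d, hcd, hd, hdc, h.isMeet_of_dom_eq_mul φ hdom⟩
  have le_trans (a b c : S) (hab : le a b) (hbc : le b c) : le a c := by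
    simp only [le] at *
    rw [← hab, mul_assoc, hbc]
  have dom_of_isMeet {a b c : S} (hc : IsMeet le a b c) :
      inv (φ c) * φ c = inv (φ a) * φ a * (inv (φ b) * φ b) := by
    obtain ⟨x, -, -, -, -, hdom⟩ := exists_multiple a b
    have hx : IsMeet le a b (x * a) := h.isMeet_of_dom_eq_mul φ hdom
    rw [← hdom]
    exact dom_eq ⟨hx.2.2 c hc.1 hc.2.1, hc.2.2 _ hx.1 hx.2.1⟩
  have rstar {a b : S} (hab : R a b) (x y : WithOne S)
      (hxy : x * (a : WithOne S) = y * (a : WithOne S)) :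
      x * (b : WithOne S) = y * (b : WithOne S) := by
    have hb := h.mul_inv_mul_of_ran_eq hab
    have cancel : WithOne.mapMulHom φ x * WithOne.mapMulHom φ (a : WithOne S) =
        WithOne.mapMulHom φ y * WithOne.mapMulHom φ (a : WithOne S) := by
      rw [← map_mul, hxy, map_mul]
    apply WithOne.mapMulHom_injective hinj
    have hb' : WithOne.mapMulHom φ (b : WithOne S) =
        WithOne.mapMulHom φ (a : WithOne S) * ((inv (φ a) * φ b : Q) : WithOne Q) := by
      rw [WithOne.mapMulHom_coe, WithOne.mapMulHom_coe, ← WithOne.coe_mul, hb]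
    rw [map_mul, map_mul, hb', ← mul_assoc, cancel, mul_assoc]
  refine ⟨⟨fun _ => rfl, Eq.symm, Eq.trans⟩, fun c a b hab => ?_, fun a => le_of_dom_eq rfl,
    le_trans, fun a b => ?_, m1, fun a b c d hc => ?_, fun a b => ?_,
    fun a b hab x y => ⟨rstar hab x y, rstar hab.symm x y⟩, fun a b c d hc hca hd hdb => ?_,
    fun a b c hab hbc hcab => ?_⟩
  · simp only [R, map_mul]
    exact h.ran_mul_ran_left hab _
  · obtain ⟨c, -, -, -, -, hc⟩ := m1 a b
    exact ⟨_, hc⟩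
  · refine h.isMeet_of_dom_eq_mul φ ?_
    simp only [map_mul]
    exact h.dom_mul_of_dom_eq_mul _ (dom_of_isMeet hc)
  · simp only [le, map_mul]
    rw [h.dom_mul_dom_eq_iff, mul_assoc, h.mul_inv_mul_self]
  · have hca' := dom_eq hca
    have hdb' := dom_eq hdb
    simp only [R, map_mul] at hc hd hca' hdb'
    have hc' := h.dom_eq_ran hc hca'
    have hd' := h.dom_eq_ran hd hdb'
    simp only [R, ← hc', ← hd']
    exact ⟨dom_eq, fun hcd => ⟨le_of_dom_eq hcd, le_of_dom_eq hcd.symm⟩⟩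
  · have hb := (dom_eq hbc).symm
    have ha := hb.trans (dom_eq hab).symm
    rw [hcab] at hb
    simp only [map_mul] at ha hb
    apply hinj
    rw [← h.dom_mul_eq_self ha, ← h.dom_mul_eq_self hb, mul_assoc, mul_assoc, ← map_mul,
      ← map_mul, hcab]
end

section
/- Let S be a semigroup with binary relations R' and ≤_l such that R' is a left compatible equivalence relation, ≤_l is a preorder whose 𝓛'-classes form a meet semilattice under ≤_l, and Conditions (M1)–(M6) hold. Then there exist an inverse semigroup Q and an injective semigroup homomorphism φ : S → Q such that every q ∈ Q can be written as q = (φ a)⁻¹·(φ b) for some a, b ∈ S with φ a 𝓡 φ b in Q, and for all a, b ∈ S: a R' b if and only if φ a 𝓡 φ b in Q, and a ≤_l b if and only if φ a ≤_𝓛 φ b in Q. -/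
universe u

namespace PEquiv

variable {α β : Type*}

theorem ext_mem {f g : α ≃. β} (hfg : ∀ x y, y ∈ f x ↔ y ∈ g x) : f = g :=
  PEquiv.ext fun x => Option.ext fun y => hfg x y

theorem mem_self_trans_symm {f : α ≃. β} {x y : α} :
    y ∈ f.trans f.symm x ↔ x = y ∧ ∃ z, z ∈ f x := by
  simp only [mem_trans, mem_iff_mem]
  constructor
  · rintro ⟨z, hx, hy⟩
    exact ⟨f.inj hx hy, z, hx⟩
  · rintro ⟨rfl, z, hz⟩
    exact ⟨z, hz, hz⟩

theorem self_trans_symm_trans_self (f : α ≃. β) : (f.trans f.symm).trans f = f := by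
  refine ext_mem fun x y => ?_
  rw [mem_trans]
  simp only [mem_self_trans_symm]
  constructor
  · rintro ⟨_, ⟨rfl, -⟩, hy⟩
    exact hy
  · exact fun hy => ⟨x, ⟨rfl, y, hy⟩, hy⟩

theorem eq_of_mem_of_trans_self {e : α ≃. α} (he : e.trans e = e) {x y : α} (hy : y ∈ e x) :
    x = y := by
  have hy' := hy
  rw [← he, mem_trans] at hy'
  obtain ⟨z, hz, hzy⟩ := hy'
  obtain rfl : y = z := Option.mem_unique hy hz
  exact e.inj hy hzy

theorem trans_comm_of_trans_self {e f : α ≃. α} (he : e.trans e = e) (hf : f.trans f = f) :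
    e.trans f = f.trans e := by
  have key : ∀ {e f : α ≃. α}, e.trans e = e → f.trans f = f → ∀ x y,
      y ∈ e.trans f x → y ∈ f.trans e x := by
    intro e f he hf x y hy
    obtain ⟨z, hz, hzy⟩ := (mem_trans _ _ _ _).1 hy
    obtain rfl := eq_of_mem_of_trans_self he hz
    obtain rfl := eq_of_mem_of_trans_self hf hzy
    exact (mem_trans _ _ _ _).2 ⟨x, hzy, hz⟩
  exact ext_mem fun x y => ⟨key he hf x y, key hf he x y⟩

theorem self_trans_symm_eq_iff {f g : α ≃. β} :
    f.trans f.symm = g.trans g.symm ↔ ∀ x, (∃ y, y ∈ f x) ↔ ∃ y, y ∈ g x := by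
  constructor
  · intro hfg x
    have : x ∈ f.trans f.symm x ↔ x ∈ g.trans g.symm x := by rw [hfg]
    simpa only [mem_self_trans_symm, true_and] using this
  · intro hfg
    refine ext_mem fun x y => ?_
    rw [mem_self_trans_symm, mem_self_trans_symm, hfg]

theorem symm_trans_self_trans_eq_iff {f g : α ≃. β} :
    (f.symm.trans f).trans (g.symm.trans g) = f.symm.trans f ↔
      ∀ y, (∃ x, y ∈ f x) → ∃ x, y ∈ g x := by
  have hmem : ∀ (f : α ≃. β) (x y : β), y ∈ f.symm.trans f x ↔ x = y ∧ ∃ z, x ∈ f z := by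
    intro f x y
    simpa only [symm_symm, mem_iff_mem] using mem_self_trans_symm (f := f.symm) (x := x) (y := y)
  constructor
  · intro hfg y hy
    have hm := (hmem f y y).2 ⟨rfl, hy⟩
    rw [← hfg, mem_trans] at hm
    obtain ⟨z, hz, hzy⟩ := hm
    obtain ⟨rfl, -⟩ := (hmem f _ _).1 hz
    exact ((hmem g _ _).1 hzy).2
  · intro hfg
    refine ext_mem fun x y => ?_
    rw [mem_trans]
    constructor
    · rintro ⟨z, hz, hzy⟩
      obtain ⟨rfl, -⟩ := (hmem g _ _).1 hzy
      exact hz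
    · intro hy
      obtain ⟨rfl, hx⟩ := (hmem f _ _).1 hy
      exact ⟨x, hy, (hmem g _ _).2 ⟨rfl, hfg x hx⟩⟩

end PEquiv

/-- The hypotheses on a semigroup `S` with relations `R` and `le` which make it a straight left
I-order. -/
structure IsStraightPair {S : Type*} [Semigroup S] (R le : S → S → Prop) : Prop where
  equiv : Equivalence R
  left : LeftCompatible R
  refl : ∀ a : S, le a a
  trans : ∀ a b c : S, le a b → le b c → le a c
  m1 : CondM1 R le
  m2 : CondM2 le
  m3 : CondM3 le
  m4 : CondM4 R
  m5 : CondM5 R le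
  m6 : CondM6 le

/-- `Covers R le c a` expresses that `c⁻¹ c = a a⁻¹` in a semigroup of quotients. -/
def Covers {S : Type*} [Semigroup S] (R le : S → S → Prop) (c a : S) : Prop :=
  R c (c * a) ∧ LpRel le (c * a) a

theorem LpRel.symm {S : Type*} {le : S → S → Prop} {a b : S} (hab : LpRel le a b) :
    LpRel le b a := ⟨hab.2, hab.1⟩

namespace IsStraightPair

variable {S : Type u} [Semigroup S] {R le : S → S → Prop}

theorem lp_trans (h : IsStraightPair R le) {a b c : S} (hab : LpRel le a b) (hbc : LpRel le b c) :
    LpRel le a c :=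
  ⟨h.trans _ _ _ hab.1 hbc.1, h.trans _ _ _ hbc.2 hab.2⟩

theorem le_mul_right (h : IsStraightPair R le) {a b : S} (c : S) (hab : le a b) :
    le (a * c) (b * c) :=
  (h.m2 a b a c ⟨h.refl a, hab, fun _ hd _ => hd⟩).2.1

theorem lp_mul_right (h : IsStraightPair R le) {a b : S} (c : S) (hab : LpRel le a b) :
    LpRel le (a * c) (b * c) :=
  ⟨h.le_mul_right c hab.1, h.le_mul_right c hab.2⟩

theorem mul_eq_mul_iff (h : IsStraightPair R le) {a b : S} (hab : R a b) (x y : S) :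
    x * a = y * a ↔ x * b = y * b := by
  have := h.m4 a b hab x y
  exact_mod_cast this

/-- Elements below `b` have, up to a covering factor, a left multiple of `b`. -/
theorem exists_covers_of_le (h : IsStraightPair R le) {y b : S} (hyb : le y b) :
    ∃ u v : S, Covers R le u y ∧ R u v ∧ R v (v * b) ∧ v * b = u * y := by
  obtain ⟨u, v, huv, hv, he, hm⟩ := h.m1 y b
  exact ⟨u, v, ⟨h.equiv.trans huv (he ▸ hv), hm.1, hm.2.2 y (h.refl y) hyb⟩, huv, hv, he⟩

theorem exists_covers (h : IsStraightPair R le) (a : S) : ∃ c : S, Covers R le c a :=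
  let ⟨u, _, hu, _⟩ := h.exists_covers_of_le (h.refl a)
  ⟨u, hu⟩

theorem lp_iff (h : IsStraightPair R le) {a b c d : S} (hc : Covers R le c a) (hd :
    Covers R le d b) :
    LpRel le c d ↔ R a b :=
  h.m5 a b c d hc.1 hc.2 hd.1 hd.2

theorem covers_mul_iff (h : IsStraightPair R le) {y a u : S} (hy : R y (y * a)) :
    Covers R le u (y * a) ↔ Covers R le u y := by
  have huy := h.left u _ _ hy
  rw [← mul_assoc] at huy
  constructor
  · intro hu
    obtain ⟨e, he⟩ := h.exists_covers y
    refine ⟨h.equiv.trans hu.1 ?_, ?_⟩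
    · rw [← mul_assoc]
      exact h.equiv.symm huy
    · exact h.lp_trans (h.lp_mul_right y ((h.lp_iff hu he).2 (h.equiv.symm hy))) he.2
  · intro hu
    refine ⟨?_, ?_⟩
    · rw [← mul_assoc]
      exact h.equiv.trans hu.1 huy
    · rw [← mul_assoc]
      exact h.lp_mul_right a hu.2

theorem rel_mul_iff_le (h : IsStraightPair R le) {c a x : S} (hc : Covers R le c a) :
    R x (x * a) ↔ le x c := by
  constructor
  · intro hx
    obtain ⟨u, v, huv, hv, he, hm⟩ := h.m1 x c
    have hux : R u (u * x) := h.equiv.trans huv (he ▸ hv)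
    have hm' := h.m2 _ _ _ a hm
    have hu : Covers R le u (x * a) := by
      refine ⟨?_, ?_⟩
      · exact h.equiv.trans hux (h.left u _ _ hx)
      · rw [← mul_assoc]
        exact ⟨hm'.1, hm'.2.2 _ (h.refl _) (h.trans _ _ _ (h.m3 x a) hc.2.2)⟩
    exact h.trans _ _ _ ((h.covers_mul_iff hx).1 hu).2.2 hm.2.1
  · intro hx
    obtain ⟨u, v, hu, huv, hv, he⟩ := h.exists_covers_of_le hx
    have hr : R (u * x) (u * x * a) := by
      rw [← he, mul_assoc]
      exact h.left v _ _ hc.1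
    have hu' : Covers R le u (x * a) := by
      refine ⟨?_, ?_⟩
      · rw [← mul_assoc]
        exact h.equiv.trans hu.1 hr
      · rw [← mul_assoc]
        exact h.lp_mul_right a hu.2
    exact (h.lp_iff hu hu').1 ⟨h.refl u, h.refl u⟩

theorem rel_mul_congr (h : IsStraightPair R le) {x y : S} (a : S) (hxy : LpRel le x y) :
    R x (x * a) ↔ R y (y * a) := by
  obtain ⟨c, hc⟩ := h.exists_covers a
  rw [h.rel_mul_iff_le hc, h.rel_mul_iff_le hc]
  exact ⟨h.trans _ _ _ hxy.2, h.trans _ _ _ hxy.1⟩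

theorem mul_right_cancel (h : IsStraightPair R le) {x y a : S} (hx : R x (x * a)) (hy : R y (y * a))
    (hxy : x * a = y * a) : x = y := by
  obtain ⟨c, d, hcd, hd, he, hm⟩ := h.m1 x y
  have hm' := h.m2 _ _ _ a hm
  have hcy : c * y = d * y := by
    rw [h.mul_eq_mul_iff hy]
    calc c * (y * a) = c * x * a := by rw [← hxy, mul_assoc]
      _ = d * (y * a) := by rw [← he, mul_assoc]
  have hcx : R c (c * x) := h.equiv.trans hcd (he ▸ hd)
  have hc : Covers R le c (x * a) := by
    refine ⟨h.equiv.trans hcx (h.left c _ _ hx), ?_⟩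
    rw [← mul_assoc]
    exact ⟨hm'.1, hm'.2.2 _ (h.refl _) (hxy ▸ h.refl _)⟩
  have hlx := ((h.covers_mul_iff hx).1 hc).2
  rw [hxy] at hc
  have hly := ((h.covers_mul_iff hy).1 hc).2
  have hcc : c * x = c * y := by rw [hcy, he]
  exact h.m6 x y c (h.lp_trans (hlx.symm) (hcc ▸ hly)) (hcc ▸ hly.symm) hcc

theorem rel_of_rel_mul (h : IsStraightPair R le) {x a b : S} (hx : R x (x * a * b)) :
    R x (x * a) := by
  obtain ⟨c, hc⟩ := h.exists_covers (x * a)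
  obtain ⟨e, he⟩ := h.exists_covers x
  obtain ⟨u, v, huv, hv, huc, hm⟩ := h.m1 c e
  have hm' := h.m2 _ _ _ (x * a) hm
  have hwa : Covers R le (u * c) (x * a) := by
    refine ⟨?_, ?_⟩
    · rw [mul_assoc u c]
      exact h.left u _ _ hc.1
    · refine h.lp_trans ⟨hm'.1, hm'.2.2 _ (h.refl _) (h.trans _ _ _ hc.2.1 ?_)⟩ hc.2
      rw [← mul_assoc e]
      exact (h.lp_mul_right a he.2).2
  have hwx : R (u * c) (u * c * x) := by
    rw [← huc, mul_assoc v e]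
    exact h.left v _ _ he.1
  have hwab : Covers R le (u * c) (x * a * b) := by
    refine ⟨?_, ?_⟩
    · exact h.equiv.trans hwx (h.left _ _ _ hx)
    · rw [← mul_assoc]
      exact h.lp_mul_right b hwa.2
  exact h.equiv.trans hx ((h.lp_iff hwab hwa).1 ⟨h.refl _, h.refl _⟩)

variable (h : IsStraightPair R le)

/-- Formal quotients `x⁻¹ y`, identified when they agree after multiplying numerator and
denominator by covers of the numerators. -/
def quotientSetoid : Setoid (S × S) where
  r p q := ∃ u v : S, Covers R le u p.2 ∧ Covers R le v q.2 ∧ u * p.1 = v * q.1 ∧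
    u * p.2 = v * q.2
  iseqv := by
    refine ⟨fun p => ?_, ?_, ?_⟩
    · obtain ⟨c, hc⟩ := h.exists_covers p.2
      exact ⟨c, c, hc, hc, rfl, rfl⟩
    · rintro p q ⟨u, v, hu, hv, h₁, h₂⟩
      exact ⟨v, u, hv, hu, h₁.symm, h₂.symm⟩
    · rintro ⟨x, y⟩ ⟨x', y'⟩ ⟨x'', y''⟩ ⟨u, u', hu, hu', h₁, h₂⟩ ⟨v, v', hv, hv', h₃, h₄⟩
      dsimp only at *
      have hl : LpRel le u' v := (h.lp_iff hu' hv).2 (h.equiv.refl _)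
      obtain ⟨p, q, hp, hpq, hq, he⟩ := h.exists_covers_of_le hl.1
      have hpy : LpRel le (p * u' * y') (u' * y') := h.lp_mul_right y' hp.2
      refine ⟨p * u, q * v', ⟨?_, ?_⟩, ⟨?_, ?_⟩, ?_, ?_⟩
      · rw [mul_assoc]
        exact h.left p _ _ hu.1
      · rw [mul_assoc, h₂, ← mul_assoc]
        exact h.lp_trans hpy (h₂ ▸ hu.2)
      · rw [mul_assoc]
        exact h.left q _ _ hv'.1
      · rw [mul_assoc, ← h₄, ← mul_assoc, he]
        exact h.lp_trans hpy (h.lp_trans hu'.2 (h.lp_trans (hv.2.symm) (h₄ ▸ hv'.2)))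
      · rw [mul_assoc, mul_assoc, h₁, ← h₃, ← mul_assoc, ← mul_assoc, he]
      · rw [mul_assoc, mul_assoc, h₂, ← h₄, ← mul_assoc, ← mul_assoc, he]

/-- The set of formal quotients on which `S` acts by partial bijections. -/
abbrev FormalQuotient : Type u := Quotient h.quotientSetoid

/-- The formal quotient `x⁻¹ y`. -/
def frac (x y : S) : h.FormalQuotient := Quotient.mk h.quotientSetoid (x, y)

theorem frac_eq_frac {x y x' y' : S} : h.frac x y = h.frac x' y' ↔
    ∃ u v : S, Covers R le u y ∧ Covers R le v y' ∧ u * x = v * x' ∧ u * y = v * y' :=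
  Quotient.eq (r := h.quotientSetoid)

theorem lp_of_frac_eq {x y x' y' : S} (he : h.frac x y = h.frac x' y') : LpRel le y y' := by
  obtain ⟨u, v, hu, hv, -, h₂⟩ := h.frac_eq_frac.1 he
  exact h.lp_trans (hu.2.symm) (h₂ ▸ hv.2)

theorem frac_mul_mul {x y u : S} (hu : Covers R le u y) : h.frac (u * x) (u * y) = h.frac x y := by
  obtain ⟨c, hc⟩ := h.exists_covers (u * y)
  refine h.frac_eq_frac.2 ⟨c, c * u, hc, ⟨?_, ?_⟩, (mul_assoc _ _ _).symm, (mul_assoc _ _ _).symm⟩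
  · rw [mul_assoc]
    exact h.left c _ _ hu.1
  · rw [mul_assoc]
    exact h.lp_trans hc.2 hu.2

/-- Right multiplication by `a` on formal quotients. -/
def Act (a : S) (X Y : h.FormalQuotient) : Prop :=
  ∃ x y : S, X = h.frac x y ∧ R y (y * a) ∧ Y = h.frac x (y * a)

theorem act_frac {a x y : S} {Y : h.FormalQuotient} :
    h.Act a (h.frac x y) Y ↔ R y (y * a) ∧ Y = h.frac x (y * a) := by
  constructor
  · rintro ⟨x', y', he, hy', rfl⟩
    have hy := (h.rel_mul_congr a (h.lp_of_frac_eq he)).2 hy'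
    obtain ⟨u, v, hu, hv, h₁, h₂⟩ := h.frac_eq_frac.1 he
    refine ⟨hy, (h.frac_eq_frac.2 ⟨u, v, (h.covers_mul_iff hy).2 hu, (h.covers_mul_iff hy').2 hv,
      h₁, ?_⟩).symm⟩
    rw [← mul_assoc, h₂, mul_assoc]
  · rintro ⟨hy, rfl⟩
    exact ⟨x, y, rfl, hy, rfl⟩

theorem act_right_unique {a : S} {X Y Z : h.FormalQuotient} (hY : h.Act a X Y)
    (hZ : h.Act a X Z) : Y = Z := by
  obtain ⟨x, y, rfl, hy, rfl⟩ := hY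
  exact (h.act_frac.1 hZ).2.symm

theorem act_left_unique {a : S} {X Y Z : h.FormalQuotient} (hX : h.Act a X Z)
    (hY : h.Act a Y Z) : X = Y := by
  obtain ⟨x, y, rfl, hy, rfl⟩ := hX
  obtain ⟨x', y', rfl, hy', he⟩ := hY
  obtain ⟨u, v, hu, hv, h₁, h₂⟩ := h.frac_eq_frac.1 he
  refine h.frac_eq_frac.2 ⟨u, v, (h.covers_mul_iff hy).1 hu, (h.covers_mul_iff hy').1 hv, h₁, ?_⟩
  refine h.mul_right_cancel (a := a) ?_ ?_ ?_
  · rw [mul_assoc]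
    exact h.left u _ _ hy
  · rw [mul_assoc]
    exact h.left v _ _ hy'
  · rw [mul_assoc, h₂, mul_assoc]

theorem act_mul {a b : S} {X Y : h.FormalQuotient} :
    h.Act (a * b) X Y ↔ ∃ Z, h.Act a X Z ∧ h.Act b Z Y := by
  constructor
  · rintro ⟨x, y, rfl, hy, rfl⟩
    rw [← mul_assoc] at hy ⊢
    have hya := h.rel_of_rel_mul hy
    exact ⟨h.frac x (y * a), h.act_frac.2 ⟨hya, rfl⟩,
      h.act_frac.2 ⟨h.equiv.trans (h.equiv.symm hya) hy, rfl⟩⟩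
  · rintro ⟨Z, ⟨x, y, rfl, hy, rfl⟩, hb⟩
    obtain ⟨hyb, rfl⟩ := h.act_frac.1 hb
    rw [mul_assoc] at hyb ⊢
    exact h.act_frac.2 ⟨h.equiv.trans hy hyb, rfl⟩

theorem exists_act_iff_rel {a x y : S} : (∃ Y, h.Act a (h.frac x y) Y) ↔ R y (y * a) :=
  ⟨fun ⟨_, hY⟩ => (h.act_frac.1 hY).1, fun hy => ⟨_, h.act_frac.2 ⟨hy, rfl⟩⟩⟩

theorem exists_act_iff_le {a x y : S} : (∃ X, h.Act a X (h.frac x y)) ↔ le y a := by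
  constructor
  · rintro ⟨_, x', y', rfl, hy', he⟩
    exact h.trans _ _ _ (h.lp_of_frac_eq he).1 (h.m3 y' a)
  · intro hya
    obtain ⟨u, v, hu, huv, hv, he⟩ := h.exists_covers_of_le hya
    exact ⟨h.frac (u * x) v, h.act_frac.2 ⟨hv, by rw [he, h.frac_mul_mul hu]⟩⟩

theorem rel_iff_dom {a b : S} : R a b ↔ ∀ X, (∃ Y, h.Act a X Y) ↔ ∃ Y, h.Act b X Y := by
  constructor
  · rintro hab ⟨x, y⟩
    have := h.left y _ _ hab
    refine h.exists_act_iff_rel.trans (Iff.trans ?_ h.exists_act_iff_rel.symm)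
    exact ⟨fun k => h.equiv.trans k this, fun k => h.equiv.trans k (h.equiv.symm this)⟩
  · intro hd
    obtain ⟨c, hc⟩ := h.exists_covers a
    obtain ⟨d, hd'⟩ := h.exists_covers b
    refine (h.lp_iff hc hd').1 ⟨?_, ?_⟩
    · rw [← h.rel_mul_iff_le hd', ← h.exists_act_iff_rel (x := a), ← hd, h.exists_act_iff_rel]
      exact hc.1
    · rw [← h.rel_mul_iff_le hc, ← h.exists_act_iff_rel (x := a), hd, h.exists_act_iff_rel]
      exact hd'.1

theorem le_iff_range {a b : S} : le a b ↔ ∀ Y, (∃ X, h.Act a X Y) → ∃ X, h.Act b X Y := by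
  constructor
  · rintro hab ⟨x, y⟩ hX
    exact h.exists_act_iff_le.2 (h.trans _ _ _ (h.exists_act_iff_le.1 hX) hab)
  · intro hr
    exact h.exists_act_iff_le.1 (hr (h.frac a a) (h.exists_act_iff_le.2 (h.refl a)))

theorem range_of_isMeet {a b c : S} (hm : IsMeet le a b c) {Y : h.FormalQuotient}
    (ha : ∃ X, h.Act a X Y) (hb : ∃ X, h.Act b X Y) : ∃ X, h.Act c X Y := by
  obtain ⟨x, y⟩ := Y
  exact h.exists_act_iff_le.2
    (hm.2.2 _ (h.exists_act_iff_le.1 ha) (h.exists_act_iff_le.1 hb))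

theorem eq_of_act {a b : S} (hab : ∀ X Y, h.Act a X Y ↔ h.Act b X Y) : a = b := by
  have hl : LpRel le a b := by
    constructor <;> rw [h.le_iff_range] <;> rintro Y ⟨X, hX⟩
    · exact ⟨X, (hab _ _).1 hX⟩
    · exact ⟨X, (hab _ _).2 hX⟩
  obtain ⟨c, hc⟩ := h.exists_covers a
  have hcb := h.act_frac.1 ((hab _ _).1 (h.act_frac.2 ⟨hc.1, rfl⟩ : h.Act a (h.frac c c) _))
  obtain ⟨u, v, hu, hv, h₁, h₂⟩ := h.frac_eq_frac.1 hcb.2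
  rw [← mul_assoc, ← mul_assoc, ← h₁] at h₂
  refine h.m6 a b (u * c) hl ?_ h₂
  rw [mul_assoc]
  exact (h.lp_trans hu.2 (h.lp_trans hc.2 hl)).symm

open Classical in
/-- The partial bijection of the set of formal quotients induced by `a`. -/
noncomputable def toPEquiv (a : S) : h.FormalQuotient ≃. h.FormalQuotient where
  toFun X := if hX : ∃ Y, h.Act a X Y then some hX.choose else none
  invFun Y := if hY : ∃ X, h.Act a X Y then some hY.choose else none
  inv X Y := by
    simp only [Option.dite_none_right_eq_some, Option.some.injEq]
    constructor
    · rintro ⟨hY, rfl⟩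
      exact ⟨⟨_, hY.choose_spec⟩,
        h.act_right_unique (Exists.choose_spec (⟨_, hY.choose_spec⟩ : ∃ Y, h.Act a _ Y))
          hY.choose_spec⟩
    · rintro ⟨hX, rfl⟩
      exact ⟨⟨_, hX.choose_spec⟩,
        h.act_left_unique (Exists.choose_spec (⟨_, hX.choose_spec⟩ : ∃ X, h.Act a X _))
          hX.choose_spec⟩

theorem mem_toPEquiv {a : S} {X Y : h.FormalQuotient} : Y ∈ h.toPEquiv a X ↔ h.Act a X Y := by
  classical
  change Y ∈ (if hX : ∃ Y, h.Act a X Y then some hX.choose else none) ↔ _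
  simp only [Option.mem_def, Option.dite_none_right_eq_some, Option.some.injEq]
  constructor
  · rintro ⟨hX, rfl⟩
    exact hX.choose_spec
  · intro hY
    exact ⟨⟨Y, hY⟩, h.act_right_unique (Exists.choose_spec (⟨Y, hY⟩ : ∃ Y, h.Act a X Y)) hY⟩

theorem toPEquiv_mul (a b : S) :
    h.toPEquiv (a * b) = (h.toPEquiv a).trans (h.toPEquiv b) := by
  refine PEquiv.ext_mem fun X Y => ?_
  rw [PEquiv.mem_trans, h.mem_toPEquiv, h.act_mul]
  simp only [h.mem_toPEquiv]

theorem toPEquiv_trans_symm {b c x y : S} (hxy : R x y) (hy : R y (y * c)) (he : y * c = x * b)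
    (hm : IsMeet le b c (x * b)) :
    (h.toPEquiv b).trans (h.toPEquiv c).symm = (h.toPEquiv x).symm.trans (h.toPEquiv y) := by
  have hx : R x (x * b) := h.equiv.trans hxy (he ▸ hy)
  refine PEquiv.ext_mem fun P Q => ?_
  simp only [PEquiv.mem_trans, PEquiv.mem_iff_mem, h.mem_toPEquiv]
  constructor
  · rintro ⟨Z, hb, hc⟩
    obtain ⟨W, hW⟩ := h.range_of_isMeet hm ⟨_, hb⟩ ⟨_, hc⟩
    refine ⟨W, ?_, ?_⟩
    · obtain ⟨V, hWV, hVZ⟩ := h.act_mul.1 hW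
      rwa [h.act_left_unique hb hVZ]
    · rw [← he] at hW
      obtain ⟨V, hWV, hVZ⟩ := h.act_mul.1 hW
      rwa [h.act_left_unique hc hVZ]
  · rintro ⟨W, hWP, hWQ⟩
    obtain ⟨Z, hZ⟩ := (h.rel_iff_dom.1 hx W).1 ⟨_, hWP⟩
    refine ⟨Z, ?_, ?_⟩
    · obtain ⟨V, hWV, hVZ⟩ := h.act_mul.1 hZ
      rwa [h.act_right_unique hWP hWV]
    · rw [← he] at hZ
      obtain ⟨V, hWV, hVZ⟩ := h.act_mul.1 hZ
      rwa [h.act_right_unique hWQ hWV]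

theorem toPEquiv_injective : Function.Injective h.toPEquiv := by
  intro a b hab
  refine h.eq_of_act fun X Y => ?_
  rw [← h.mem_toPEquiv, hab, h.mem_toPEquiv]

theorem toPEquiv_eq_of_covers {a c : S} (hc : Covers R le c a) :
    h.toPEquiv a = (h.toPEquiv c).symm.trans (h.toPEquiv (c * a)) := by
  refine PEquiv.ext_mem fun X Y => ?_
  simp only [PEquiv.mem_trans, PEquiv.mem_iff_mem, h.mem_toPEquiv, h.act_mul]
  constructor
  · rintro ⟨x, y, rfl, hy, rfl⟩
    obtain ⟨W, hW⟩ := (h.exists_act_iff_le (x := x)).2 ((h.rel_mul_iff_le hc).1 hy)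
    exact ⟨W, hW, _, hW, h.act_frac.2 ⟨hy, rfl⟩⟩
  · rintro ⟨W, hX, Z, hZ, hY⟩
    rwa [h.act_right_unique hX hZ]

/-- A partial bijection is straight if it is a quotient `a⁻¹ b` with `R a b`. -/
def IsStraight (f : h.FormalQuotient ≃. h.FormalQuotient) : Prop :=
  ∃ a b : S, R a b ∧ f = (h.toPEquiv a).symm.trans (h.toPEquiv b)

theorem isStraight_toPEquiv (a : S) : h.IsStraight (h.toPEquiv a) :=
  let ⟨c, hc⟩ := h.exists_covers a
  ⟨c, c * a, hc.1, h.toPEquiv_eq_of_covers hc⟩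

variable {h}

theorem IsStraight.symm {f : h.FormalQuotient ≃. h.FormalQuotient} (hf : h.IsStraight f) :
    h.IsStraight f.symm := by
  obtain ⟨a, b, hab, rfl⟩ := hf
  exact ⟨b, a, h.equiv.symm hab, rfl⟩

theorem IsStraight.trans {f g : h.FormalQuotient ≃. h.FormalQuotient} (hf : h.IsStraight f)
    (hg : h.IsStraight g) : h.IsStraight (f.trans g) := by
  obtain ⟨a, b, hab, rfl⟩ := hf
  obtain ⟨c, d, hcd, rfl⟩ := hg
  obtain ⟨x, y, hxy, hy, he, hm⟩ := h.m1 b c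
  refine ⟨x * a, y * d, ?_, ?_⟩
  · exact h.equiv.trans (h.left x _ _ hab) (he ▸ h.left y _ _ hcd)
  · calc _ = (h.toPEquiv a).symm.trans
          (((h.toPEquiv b).trans (h.toPEquiv c).symm).trans (h.toPEquiv d)) := by
          simp only [PEquiv.trans_assoc]
      _ = _ := by
          rw [h.toPEquiv_trans_symm hxy hy he hm, h.toPEquiv_mul, h.toPEquiv_mul,
            PEquiv.symm_trans_rev]
          simp only [PEquiv.trans_assoc]

end IsStraightPair

/-- sufficiency direction of Theorem `main`: a semigroup satisfying the
conditions has an inverse semigroup of straight left I-quotients realizing the given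
relations as the restrictions of 𝓡 and ≤_𝓛. -/
theorem main_sufficiency
    {S : Type u} [Semigroup S] (R le : S → S → Prop)
    (hR : Equivalence R) (hRl : LeftCompatible R)
    (hrefl : ∀ a : S, le a a) (htrans : ∀ a b c : S, le a b → le b c → le a c)
    (hmeet : ∀ a b : S, ∃ c : S, IsMeet le a b c)
    (h1 : CondM1 R le) (h2 : CondM2 le) (h3 : CondM3 le)
    (h4 : CondM4 R) (h5 : CondM5 R le) (h6 : CondM6 le) :
    ∃ (Q : Type u) (mul : Q → Q → Q) (inv : Q → Q) (φ : S → Q),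
      (∀ a b c : Q, mul (mul a b) c = mul a (mul b c)) ∧
      (∀ a : Q, mul (mul a (inv a)) a = a) ∧
      (∀ a : Q, mul (mul (inv a) a) (inv a) = inv a) ∧
      (∀ e f : Q, mul e e = e → mul f f = f → mul e f = mul f e) ∧
      (∀ a b : S, φ (a * b) = mul (φ a) (φ b)) ∧
      Function.Injective φ ∧
      (∀ q : Q, ∃ a b : S,
        q = mul (inv (φ a)) (φ b) ∧ mul (φ a) (inv (φ a)) = mul (φ b) (inv (φ b))) ∧
      (∀ a b : S, R a b ↔ mul (φ a) (inv (φ a)) = mul (φ b) (inv (φ b))) ∧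
      (∀ a b : S, le a b ↔
        mul (mul (inv (φ a)) (φ a)) (mul (inv (φ b)) (φ b)) = mul (inv (φ a)) (φ a)) := by
  have h : IsStraightPair R le := ⟨hR, hRl, hrefl, htrans, h1, h2, h3, h4, h5, h6⟩
  refine ⟨{f // h.IsStraight f}, fun f g => ⟨f.1.trans g.1, f.2.trans g.2⟩,
    fun f => ⟨f.1.symm, f.2.symm⟩, fun a => ⟨h.toPEquiv a, h.isStraight_toPEquiv a⟩,
    ?_, ?_, ?_, ?_, ?_, ?_, ?_, ?_, ?_⟩
  · exact fun f g k => Subtype.ext (PEquiv.trans_assoc _ _ _)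
  · exact fun f => Subtype.ext (PEquiv.self_trans_symm_trans_self _)
  · exact fun f => Subtype.ext (PEquiv.self_trans_symm_trans_self f.1.symm)
  · exact fun e f he hf => Subtype.ext
      (PEquiv.trans_comm_of_trans_self (Subtype.ext_iff.1 he) (Subtype.ext_iff.1 hf))
  · exact fun a b => Subtype.ext (h.toPEquiv_mul a b)
  · exact fun a b hab => h.toPEquiv_injective (Subtype.ext_iff.1 hab)
  · rintro ⟨_, a, b, hab, rfl⟩
    refine ⟨a, b, rfl, Subtype.ext (PEquiv.self_trans_symm_eq_iff.2 ?_)⟩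
    simpa only [h.mem_toPEquiv] using h.rel_iff_dom.1 hab
  · intro a b
    rw [Subtype.ext_iff, PEquiv.self_trans_symm_eq_iff, h.rel_iff_dom]
    simp only [h.mem_toPEquiv]
  · intro a b
    rw [Subtype.ext_iff, PEquiv.symm_trans_self_trans_eq_iff, h.le_iff_range]
    simp only [h.mem_toPEquiv]
end

section
/- Let S be a semigroup with binary relations R' and ≤_l such that R' is a left compatible equivalence relation, ≤_l is a preorder whose 𝓛'-classes form a meet semilattice under ≤_l, and Conditions (M1)–(M6) hold. Then: (i) for every a ∈ S there exists x ∈ S with x R' (x·a) and (x·a) 𝓛' a; (ii) if x R' (x·a), (x·a) 𝓛' a and a R' b, then x R' (x·b) and (x·b) 𝓛' b; (iii) for all x, a ∈ S, x·a realizes the meet of the 𝓛'-classes of x·a and a, i.e., L'_{x·a} ∧ L'_a = L'_{x·a}; (iv) if a R' b and (x·a) 𝓛' (y·a), then (x·b) 𝓛' (y·b). -/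
/-- Lemma `secprops`: basic consequences of conditions (M1)-(M6). -/
theorem secprops
    {S : Type*} [Semigroup S] (R le : S → S → Prop)
    (hR : Equivalence R) (hRl : LeftCompatible R)
    (hrefl : ∀ a : S, le a a) (htrans : ∀ a b c : S, le a b → le b c → le a c)
    (hmeet : ∀ a b : S, ∃ c : S, IsMeet le a b c)
    (h1 : CondM1 R le) (h2 : CondM2 le) (h3 : CondM3 le)
    (h4 : CondM4 R) (h5 : CondM5 R le) (h6 : CondM6 le) :
    (∀ a : S, ∃ x : S, R x (x * a) ∧ LpRel le (x * a) a) ∧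
    (∀ a b x : S, R x (x * a) → LpRel le (x * a) a → R a b →
      R x (x * b) ∧ LpRel le (x * b) b) ∧
    (∀ x a : S, IsMeet le (x * a) a (x * a)) ∧
    (∀ a b x y : S, R a b → LpRel le (x * a) (y * a) → LpRel le (x * b) (y * b)) := by
  have le_mul {x y : S} (b : S) (hxy : le x y) : le (x * b) (y * b) :=
    (h2 x y x b ⟨hrefl x, hxy, fun _ hd _ => hd⟩).2.1
  have exists_section (a : S) : ∃ x : S, R x (x * a) ∧ LpRel le (x * a) a := by
    obtain ⟨c, d, -, hd, hdc, hm⟩ := h1 a a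
    exact ⟨d, hd, h3 d a, hdc ▸ hm.2.2 a (hrefl a) (hrefl a)⟩
  have section_congr (a b x : S) (hx : R x (x * a)) (hxa : LpRel le (x * a) a) (hab : R a b) :
      R x (x * b) ∧ LpRel le (x * b) b := by
    obtain ⟨y, hy, hyb⟩ := exists_section b
    have hxy : LpRel le x y := (h5 a b x y hx hxa hy hyb).2 hab
    exact ⟨hR.trans hx (hRl x a b hab), h3 x b, htrans _ _ _ hyb.2 (le_mul b hxy.2)⟩
  refine ⟨exists_section, section_congr,
    fun x a => ⟨hrefl _, h3 x a, fun _ hd _ => hd⟩, ?_⟩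
  intro a b x y hab hxy
  obtain ⟨c, d, hcd, hd, hdc, -, -, hm⟩ := h1 (x * a) (y * a)
  have hx : LpRel le (c * (x * a)) (x * a) := ⟨h3 _ _, hm _ (hrefl _) hxy.1⟩
  have hy : LpRel le (d * (y * a)) (y * a) := ⟨h3 _ _, hdc ▸ hm _ hxy.2 (hrefl _)⟩
  have hxb := (section_congr _ _ c (hdc ▸ hR.trans hcd hd) hx (hRl x a b hab)).2
  have hyb := (section_congr _ _ d hd hy (hRl y a b hab)).2
  have heq : d * (y * b) = c * (x * b) := by
    have h := (h4 a b hab ((d * y : S) : WithOne S) ((c * x : S) : WithOne S)).1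
    simp only [← WithOne.coe_mul, WithOne.coe_inj, mul_assoc] at h
    exact h hdc
  rw [heq] at hyb
  exact ⟨htrans _ _ _ hxb.2 hyb.1, htrans _ _ _ hyb.2 hxb.1⟩
end

section
/- Let S be a semigroup with binary relations R' and ≤_l such that R' is a left compatible equivalence relation, ≤_l is a preorder whose 𝓛'-classes form a meet semilattice under ≤_l, and Conditions (M1)–(M6) hold. Define Σ = {(a, b) ∈ S × S : a R' b}, and for (a, b), (c, d) ∈ Σ declare (a, b) ∼ (c, d) if there exist x, y ∈ S with x·a = y·c, x·b = y·d, x R' (x·a), (x·a) 𝓛' a, y R' (y·c), and (y·c) 𝓛' c. Then ∼ is reflexive, symmetric and transitive on Σ, i.e., an equivalence relation on Σ. -/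
/-- Under (M2), a reflexive `le` is preserved by right multiplication. -/
theorem le_mul_right_of_condM2 {S : Type*} [Semigroup S] {le : S → S → Prop}
    (hrefl : ∀ a : S, le a a) (h2 : CondM2 le) {a b : S} (h : le a b) (c : S) :
    le (a * c) (b * c) :=
  (h2 a b a c ⟨hrefl a, h, fun _ hd _ => hd⟩).2.1

/-- Lemma `ER`: the relation `∼` is an equivalence relation on
`Σ = {(a, b) ∈ S × S : a R' b}`. -/
theorem sim_equivalence
    {S : Type*} [Semigroup S] (R le : S → S → Prop)
    (hR : Equivalence R) (hRl : LeftCompatible R)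
    (hrefl : ∀ a : S, le a a) (htrans : ∀ a b c : S, le a b → le b c → le a c)
    (hmeet : ∀ a b : S, ∃ c : S, IsMeet le a b c)
    (h1 : CondM1 R le) (h2 : CondM2 le) (h3 : CondM3 le)
    (h4 : CondM4 R) (h5 : CondM5 R le) (h6 : CondM6 le) :
    Equivalence (fun p q : {p : S × S // R p.1 p.2} =>
      ∃ x y : S, x * p.1.1 = y * q.1.1 ∧ x * p.1.2 = y * q.1.2 ∧
        R x (x * p.1.1) ∧ LpRel le (x * p.1.1) p.1.1 ∧
        R y (y * q.1.1) ∧ LpRel le (y * q.1.1) q.1.1) := by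
  refine ⟨?_, ?_, ?_⟩
  · rintro ⟨⟨a, b⟩, -⟩
    obtain ⟨c, d, -, hd, hdc, hm⟩ := h1 a a
    have hL : LpRel le (d * a) a := hdc ▸ ⟨hm.1, hm.2.2 a (hrefl a) (hrefl a)⟩
    exact ⟨d, d, rfl, rfl, hd, hL, hd, hL⟩
  · rintro p q ⟨x, y, h, h', hx, hxL, hy, hyL⟩
    exact ⟨y, x, h.symm, h'.symm, hy, hyL, hx, hxL⟩
  · rintro ⟨⟨a, b⟩, _⟩ ⟨⟨c, d⟩, _⟩ ⟨⟨e, f⟩, _⟩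
      ⟨x, y, hac, hbd, hx, hxL, hy, hyL⟩ ⟨z, w, hce, hdf, hz, hzL, hw, hwL⟩
    dsimp only at hac hbd hx hxL hy hyL hce hdf hz hzL hw hwL
    have hyz : LpRel le y z := (h5 c c y z hy hyL hz hzL).2 (hR.refl c)
    obtain ⟨s, t, -, -, hts, hm⟩ := h1 y z
    have hmul (u v : S) (h : x * u = y * v) : s * x * u = s * y * v := by
      rw [mul_assoc, h, mul_assoc]
    have hmul' (u v : S) (h : z * v = w * u) : s * y * v = t * w * u := by
      rw [← hts, mul_assoc, h, mul_assoc]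
    refine ⟨s * x, t * w, (hmul a c hac).trans (hmul' e c hce),
      (hmul b d hbd).trans (hmul' f d hdf), ?_, ?_, ?_, ?_⟩
    · rw [mul_assoc]
      exact hRl s _ _ hx
    · rw [hmul a c hac]
      have hle := le_mul_right_of_condM2 hrefl h2 (hm.2.2 y (hrefl y) hyz.1) c
      have hge := le_mul_right_of_condM2 hrefl h2 hm.1 c
      rw [← hac] at hle hge
      exact ⟨htrans _ _ _ hge hxL.1, htrans _ _ _ hxL.2 hle⟩
    · rw [mul_assoc]
      exact hRl t _ _ hw
    · rw [← hmul' e c hce]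
      have hle := le_mul_right_of_condM2 hrefl h2 (hm.2.2 z hyz.2 (hrefl z)) c
      have hge := le_mul_right_of_condM2 hrefl h2 hm.2.1 c
      rw [hce] at hle hge
      exact ⟨htrans _ _ _ hge hwL.1, htrans _ _ _ hwL.2 hle⟩
end

section
/- Let S be a semigroup with binary relations R' and ≤_l such that R' is a left compatible equivalence relation, ≤_l is a preorder whose 𝓛'-classes form a meet semilattice under ≤_l, and Conditions (M1)–(M6) hold. Let ∼ be the relation defined on Σ = {(a, b) ∈ S × S : a R' b} by: (a, b) ∼ (c, d) iff there exist x, y ∈ S with x·a = y·c, x·b = y·d, x R' (x·a), (x·a) 𝓛' a, y R' (y·c), and (y·c) 𝓛' c. Then for all a, b ∈ S, (a, a) ∼ (b, b) if and only if a 𝓛' b. -/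
/-- Lemma `extras` (i): `(a, a) ∼ (b, b)` if and only if `a 𝓛' b`. -/
theorem sim_idempotent_pairs_iff
    {S : Type*} [Semigroup S] (R le : S → S → Prop)
    (hR : Equivalence R) (hRl : LeftCompatible R)
    (hrefl : ∀ a : S, le a a) (htrans : ∀ a b c : S, le a b → le b c → le a c)
    (hmeet : ∀ a b : S, ∃ c : S, IsMeet le a b c)
    (h1 : CondM1 R le) (h2 : CondM2 le) (h3 : CondM3 le)
    (h4 : CondM4 R) (h5 : CondM5 R le) (h6 : CondM6 le)
    (a b : S) :
    (∃ x y : S, x * a = y * b ∧ x * a = y * b ∧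
      R x (x * a) ∧ LpRel le (x * a) a ∧
      R y (y * b) ∧ LpRel le (y * b) b) ↔ LpRel le a b := by
  constructor
  · rintro ⟨x, y, hxy, -, -, hxa, -, hyb⟩
    rw [← hxy] at hyb
    exact ⟨htrans _ _ _ hxa.2 hyb.1, htrans _ _ _ hyb.2 hxa.1⟩
  · rintro ⟨hab, hba⟩
    obtain ⟨c, d, hcd, hd, hdc, hca, hcb, hinf⟩ := h1 a b
    refine ⟨c, d, hdc.symm, hdc.symm, hdc ▸ hR.trans hcd hd,
      ⟨hca, hinf a (hrefl a) hab⟩, hd, ?_⟩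
    rw [hdc]
    exact ⟨hcb, hinf b hba (hrefl b)⟩
end

section
/- Let S be a semigroup whose idempotents commute, and let e, f ∈ S be idempotents. Then e·f is a greatest lower bound of e and f with respect to ≤_{𝓛*}: e·f ≤_{𝓛*} e, e·f ≤_{𝓛*} f, and every h ∈ S with h ≤_{𝓛*} e and h ≤_{𝓛*} f satisfies h ≤_{𝓛*} e·f. -/
/-- The preorder ≤_{𝓛*} on a semigroup, defined via `S¹ = WithOne S`. -/
def LeLStar {S : Type*} [Semigroup S] (a b : S) : Prop :=
  ∀ x y : WithOne S,
    (b : WithOne S) * x = (b : WithOne S) * y → (a : WithOne S) * x = (a : WithOne S) * y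

/-- Everything below an idempotent `e` for ≤_{𝓛*} is fixed by right multiplication by `e`. -/
theorem LeLStar.coe_mul_idempotent {S : Type*} [Semigroup S] {h e : S} (hle : LeLStar h e)
    (he : e * e = e) : (h : WithOne S) * (e : WithOne S) = h := by
  have := hle e 1 (by rw [mul_one, ← WithOne.coe_mul, he])
  rwa [mul_one] at this

/-- A left multiple of `b` lies below `b` for ≤_{𝓛*}. -/
theorem leLStar_mul_left {S : Type*} [Semigroup S] (a b : S) : LeLStar (a * b) b := by
  intro x y hxy
  rw [WithOne.coe_mul, mul_assoc, hxy, mul_assoc]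

/-- In a semigroup whose idempotents commute, the product `e·f` of two
idempotents is a greatest lower bound of `e` and `f` with respect to ≤_{𝓛*}. -/
theorem idempotent_meet_LStar
    {S : Type*} [Semigroup S]
    (hcomm : ∀ e f : S, e * e = e → f * f = f → e * f = f * e)
    (e f : S) (he : e * e = e) (hf : f * f = f) :
    LeLStar (e * f) e ∧ LeLStar (e * f) f ∧
      ∀ h : S, LeLStar h e → LeLStar h f → LeLStar h (e * f) := by
  refine ⟨hcomm e f he hf ▸ leLStar_mul_left f e, leLStar_mul_left e f, ?_⟩
  intro h hle hlf x y hxy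
  have hfix : (h : WithOne S) * ((e * f : S) : WithOne S) = h := by
    rw [WithOne.coe_mul, ← mul_assoc, hle.coe_mul_idempotent he, hlf.coe_mul_idempotent hf]
  rw [← hfix, mul_assoc, hxy, mul_assoc]
end

section
/- Let Q be an inverse semigroup and let S be a subsemigroup of Q which, as a semigroup in its own right, is right ample with unary operation star : S → S. Then star(a) = a⁻¹·a for all a ∈ S (i.e., S is embedded in Q as a unary semigroup) if and only if for all a, b ∈ S: a 𝓛 b in Q ⇔ a 𝓛* b in S. -/
theorem LeLStar.trans {S : Type*} [Semigroup S] {a b c : S} (hab : LeLStar a b)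
    (hbc : LeLStar b c) : LeLStar a c :=
  fun x y h => hab x y (hbc x y h)

theorem LeLStar.mul_eq_of_isIdempotentElem {S : Type*} [Semigroup S] {e f : S}
    (h : LeLStar e f) (hf : f * f = f) : e * f = e := by
  have h1 := h (f : WithOne S) 1 (by rw [mul_one, ← WithOne.coe_mul, hf])
  rwa [mul_one, ← WithOne.coe_mul, WithOne.coe_inj] at h1

/-- Lemma `ampleL*`: a right ample subsemigroup `S` of an inverse
semigroup `Q` is embedded as a unary semigroup (i.e. `star a = a⁻¹·a` for all
`a ∈ S`) iff the restriction of 𝓛^Q to `S` is 𝓛*. -/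
theorem right_ample_unary_embedding_iff
    {Q : Type*} [Semigroup Q] (inv : Q → Q)
    (hinv1 : ∀ a : Q, a * inv a * a = a)
    (hinv2 : ∀ a : Q, inv a * a * inv a = inv a)
    (hcomm : ∀ e f : Q, e * e = e → f * f = f → e * f = f * e)
    (S : Subsemigroup Q) (star : S → S)
    (hScomm : ∀ e f : S, e * e = e → f * f = f → e * f = f * e)
    (hidem : ∀ a : S, star a * star a = star a)
    (hLstar : ∀ a : S, LeLStar a (star a) ∧ LeLStar (star a) a)
    (hample : ∀ a b : S, star a * b = b * star (a * b)) :
    (∀ a : S, (star a : Q) = inv (a : Q) * (a : Q)) ↔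
      (∀ a b : S, inv (a : Q) * (a : Q) = inv (b : Q) * (b : Q) ↔
        (LeLStar a b ∧ LeLStar b a)) := by
  constructor
  · intro hstar a b
    constructor
    · intro h
      have hab : star a = star b := Subtype.ext (by rw [hstar, hstar, h])
      exact ⟨(hLstar a).1.trans (hab ▸ (hLstar b).2), (hLstar b).1.trans (hab ▸ (hLstar a).2)⟩
    · rintro ⟨hab, hba⟩
      have h1 := (((hLstar a).2.trans hab).trans
        (hLstar b).1).mul_eq_of_isIdempotentElem (hidem b)
      have h2 := (((hLstar b).2.trans hba).trans
        (hLstar a).1).mul_eq_of_isIdempotentElem (hidem a)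
      rw [← hstar, ← hstar, ← h1, hScomm _ _ (hidem a) (hidem b), h2]
  · intro h a
    have he : (star a : Q) * star a = star a := congrArg Subtype.val (hidem a)
    rw [(h a (star a)).2 (hLstar a)]
    generalize (star a : Q) = e at he
    have hf : inv e * e * (inv e * e) = inv e * e := by rw [← mul_assoc, hinv2]
    calc e = e * (inv e * e) := by rw [← mul_assoc, hinv1]
      _ = inv e * e * e := hcomm _ _ he hf
      _ = inv e * e := by rw [mul_assoc, he]
end

section
/- Let Q be an inverse semigroup and let S be a subsemigroup of Q which, as a semigroup in its own right, is right ample with unary operation star : S → S, and suppose star(a) = a⁻¹·a for all a ∈ S. Then for all a, b, c, x ∈ S: (i) a ≤_𝓛 b in Q ⇔ star(a)·star(b) = star(a) ⇔ a ≤_{𝓛*} b in S; (ii) c⁻¹·c = a⁻¹·a·b⁻¹·b (i.e., the 𝓛-class of c in Q is the meet of those of a and b) if and only if star(c) = star(a)·star(b); (iii) (x·a)⁻¹·(x·a) = a⁻¹·a·b⁻¹·b if and only if a·star(b) = star(x)·a. -/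
/-- Lemma `Right ample meet`: properties of a right ample semigroup
embedded as a unary subsemigroup of an inverse semigroup. -/
theorem right_ample_meet
    {Q : Type*} [Semigroup Q] (inv : Q → Q)
    (hinv1 : ∀ a : Q, a * inv a * a = a)
    (hinv2 : ∀ a : Q, inv a * a * inv a = inv a)
    (hcomm : ∀ e f : Q, e * e = e → f * f = f → e * f = f * e)
    (S : Subsemigroup Q) (star : S → S)
    (hScomm : ∀ e f : S, e * e = e → f * f = f → e * f = f * e)
    (hidem : ∀ a : S, star a * star a = star a)
    (hLstar : ∀ a : S, LeLStar a (star a) ∧ LeLStar (star a) a)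
    (hample : ∀ a b : S, star a * b = b * star (a * b))
    (hstar : ∀ a : S, (star a : Q) = inv (a : Q) * (a : Q))
    (a b c x : S) :
    ((inv (a : Q) * (a : Q) * (inv (b : Q) * (b : Q)) = inv (a : Q) * (a : Q) ↔
        star a * star b = star a) ∧
      (star a * star b = star a ↔ LeLStar a b)) ∧
    (inv (c : Q) * (c : Q) = inv (a : Q) * (a : Q) * (inv (b : Q) * (b : Q)) ↔
      star c = star a * star b) ∧
    (inv ((x * a : S) : Q) * ((x * a : S) : Q) =
        inv (a : Q) * (a : Q) * (inv (b : Q) * (b : Q)) ↔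
      a * star b = star x * a) := by
  have mul_star : ∀ a : S, a * star a = a := fun a => Subtype.ext <| by
    rw [MulMemClass.coe_mul, hstar, ← mul_assoc, hinv1]
  have star_congr : ∀ a u v : S, a * u = a * v → star a * u = star a * v := by
    intro a u v h
    apply Subtype.ext
    have h' : (a : Q) * u = a * v := congrArg Subtype.val h
    rw [MulMemClass.coe_mul, MulMemClass.coe_mul, hstar, mul_assoc, mul_assoc, h']
  have star_mul_star : ∀ a b : S,
      ((star a * star b : S) : Q) = inv (a : Q) * a * (inv (b : Q) * b) := by
    intro a b
    rw [MulMemClass.coe_mul, hstar, hstar]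
  refine ⟨⟨?_, ?_, ?_⟩, ?_, ?_⟩
  · rw [← star_mul_star, ← hstar, Subtype.coe_inj]
  · intro h u v huv
    have h₁ := (hLstar b).2 u v huv
    apply (hLstar a).1
    rw [← h, WithOne.coe_mul, mul_assoc, mul_assoc, h₁]
  · intro h
    have h₁ := h 1 (star b) (by rw [mul_one, ← WithOne.coe_mul, mul_star])
    rw [mul_one, ← WithOne.coe_mul, WithOne.coe_inj] at h₁
    rw [star_congr a (star b) (star a) (by rw [← h₁, mul_star]), hidem]
  · rw [← star_mul_star, ← hstar, Subtype.coe_inj]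
  · rw [← star_mul_star, ← hstar, Subtype.coe_inj, hample x a]
    constructor
    · intro h
      rw [h, ← mul_assoc, mul_star]
    · intro h
      have star_mul_le : star (x * a) * star a = star (x * a) := by
        have := star_congr (x * a) (star a) (star (x * a))
          (by rw [mul_star, mul_assoc, mul_star])
        rw [this, hidem]
      rw [star_congr a _ _ h, hScomm _ _ (hidem a) (hidem _), star_mul_le]
end
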